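/- arXiv:2308.05208 — 4 statements merged into one kernel-verified Lean document; each statement's English description precedes it below -/
import Mathlib

section
/- For all integers d ≥ 1 and k ≥ 1, there is a constant c (depending only on d and k) such that ψ^max_{d,k}(n) ≤ c · n^{2dk} for all positive integers n. -/
/-- `sumDist V x = Σ_{v ∈ V} ‖x − v‖` (with multiplicity): the sum of Euclidean
distances from `x` to the points of the multiset `V`. -/
noncomputable def sumDist {d : ℕ} (V : Multiset (EuclideanSpace ℝ (Fin d)))
    (x : EuclideanSpace ℝ (Fin d)) : ℝ :=
  (V.map fun v => dist x v).sum

/-- `PsiSet k n C` is the set of orderings `Σ_V^C` of the `n`-element set `C ⊆ ℝ^d`,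
recorded as injective enumerations `σ : Fin n → ℝ^d` of `C`, witnessed by some
`k`-element multiset `V` of vantage points which distinguishes the points of `C`
(i.e. `D_V` is injective on `C`) and along which `D_V` is strictly increasing. -/
def PsiSet {d : ℕ} (k n : ℕ) (C : Finset (EuclideanSpace ℝ (Fin d))) :
    Set (Fin n → EuclideanSpace ℝ (Fin d)) :=
  {σ | Function.Injective σ ∧ (∀ i, σ i ∈ C) ∧
    ∃ V : Multiset (EuclideanSpace ℝ (Fin d)), Multiset.card V = k ∧
      Set.InjOn (sumDist V) ↑C ∧ StrictMono fun i => sumDist V (σ i)}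

/-- `ψ_k(C)`, the number of orderings of `C` witnessed by `k`-element multisets. -/
noncomputable def psiCount {d : ℕ} (k : ℕ) (C : Finset (EuclideanSpace ℝ (Fin d))) : ℕ :=
  Nat.card (PsiSet k C.card C)

/-- `ψ^max_{d,k}(n)`: the maximum of `ψ_k(C)` over all `n`-element sets `C ⊆ ℝ^d`. -/
noncomputable def psiMax (d k n : ℕ) : ℕ :=
  sSup {m | ∃ C : Finset (EuclideanSpace ℝ (Fin d)), C.card = n ∧ psiCount k C = m}

open MvPolynomial

theorem totalDegree_pderiv_le {ι : Type*} (j : ι) (P : MvPolynomial ι ℝ) :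
    (pderiv j P).totalDegree ≤ P.totalDegree := by
  classical
  conv_lhs => rw [P.as_sum, map_sum]
  refine totalDegree_finsetSum_le fun s hs => ?_
  rw [pderiv_monomial]
  refine (totalDegree_monomial_le _ _).trans (le_trans ?_ (le_totalDegree hs))
  change (s - Finsupp.single j 1).degree ≤ s.degree
  exact Finsupp.degree_mono tsub_le_self

theorem totalDegree_aeval_le_of_totalDegree_le_one {σ ι : Type*} (f : σ → MvPolynomial ι ℝ)
    (hf : ∀ i, (f i).totalDegree ≤ 1) (P : MvPolynomial σ ℝ) :
    (aeval f P).totalDegree ≤ P.totalDegree := by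
  classical
  conv_lhs => rw [P.as_sum, map_sum]
  refine totalDegree_finsetSum_le fun s hs => ?_
  rw [aeval_monomial]
  refine (totalDegree_mul _ _).trans ?_
  rw [algebraMap_eq, totalDegree_C, zero_add]
  refine ((totalDegree_finsetProd _ _).trans ?_).trans (le_totalDegree hs)
  refine Finset.sum_le_sum fun i _ => (totalDegree_pow _ _).trans ?_
  simpa using Nat.mul_le_mul_left (s i) (hf i)

theorem dense_eval_ne_zero {ι : Type*} [Finite ι] {P : MvPolynomial ι ℝ} (hP : P ≠ 0) :
    Dense {x : ι → ℝ | eval x P ≠ 0} := by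
  have := Fintype.ofFinite ι
  rw [Metric.dense_iff]
  intro x r hr
  by_contra h
  refine hP (funext_set (fun i => Metric.ball (x i) r) (fun i => ?_) fun y hy => ?_)
  · rw [Real.ball_eq_Ioo]
    exact Set.Ioo_infinite (by linarith)
  · by_contra hne
    refine h ⟨y, ?_, by simpa using hne⟩
    rw [ball_pi _ hr]
    exact hy

theorem isOpen_eval_ne_zero {ι : Type*} (P : MvPolynomial ι ℝ) :
    IsOpen {x : ι → ℝ | eval x P ≠ 0} :=
  isOpen_ne_fun P.continuous_eval continuous_const

theorem hasDerivAt_eval_update {ι : Type*} [DecidableEq ι] (P : MvPolynomial ι ℝ) (x : ι → ℝ)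
    (j : ι) : HasDerivAt (fun t => eval (Function.update x j t) P) (eval x (pderiv j P)) (x j) := by
  induction P using MvPolynomial.induction_on with
  | C a => simpa using hasDerivAt_const _ _
  | add p q hp hq => simpa using hp.fun_add hq
  | mul_X p i hp =>
    have hX : HasDerivAt (fun t => Function.update x j t i) ((Pi.single j 1 : ι → ℝ) i) (x j) := by
      rcases eq_or_ne i j with rfl | h
      · simpa using hasDerivAt_id' _
      · simpa [h] using hasDerivAt_const _ _
    have := hp.fun_mul hX
    simp only [map_mul, eval_X, Derivation.leibniz, smul_eq_mul, map_add, pderiv_X,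
      Function.update_eq_self] at this ⊢
    refine this.congr_deriv ?_
    rcases eq_or_ne i j with rfl | h
    · simp [mul_comm, add_comm]
    · simp [h, mul_comm]

theorem exists_abs_eval_le {ι : Type*} [Fintype ι] (P : MvPolynomial ι ℝ) :
    ∃ C : ℝ, ∃ n : ℕ, 0 ≤ C ∧ ∀ x : ι → ℝ, |eval x P| ≤ C * (1 + ‖x‖) ^ n := by
  induction P using MvPolynomial.induction_on with
  | C a => exact ⟨|a|, 0, abs_nonneg a, by simp⟩
  | add p q hp hq =>
    obtain ⟨C, n, hC, h⟩ := hp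
    obtain ⟨C', n', hC', h'⟩ := hq
    refine ⟨C + C', n + n', by positivity, fun x => ?_⟩
    have h1 : (1 : ℝ) ≤ 1 + ‖x‖ := by simp
    calc |eval x (p + q)| ≤ |eval x p| + |eval x q| := by
          rw [map_add]; exact abs_add_le _ _
      _ ≤ C * (1 + ‖x‖) ^ n + C' * (1 + ‖x‖) ^ n' := add_le_add (h x) (h' x)
      _ ≤ C * (1 + ‖x‖) ^ (n + n') + C' * (1 + ‖x‖) ^ (n + n') := by
          gcongr <;> first | exact h1 | omega
      _ = _ := by ring
  | mul_X p i hp =>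
    obtain ⟨C, n, hC, h⟩ := hp
    refine ⟨C, n + 1, hC, fun x => ?_⟩
    rw [map_mul, eval_X, abs_mul, pow_succ, ← mul_assoc]
    have h2 : |x i| ≤ 1 + ‖x‖ := (norm_le_pi_norm x i).trans (by simp)
    gcongr
    exact h x

theorem tendsto_add_pow_mul_exp_neg_sq (K : ℝ) (n : ℕ) :
    Filter.Tendsto (fun u : ℝ => (K + u) ^ n * Real.exp (-u ^ 2)) Filter.atTop (nhds 0) := by
  have h := ((Real.tendsto_pow_mul_exp_neg_atTop_nhds_zero n).comp
    (Filter.tendsto_atTop_add_const_left _ K Filter.tendsto_id)).const_mul (Real.exp K)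
  rw [mul_zero] at h
  refine squeeze_zero' ?_ ?_ h
  · filter_upwards [Filter.eventually_ge_atTop (-K)] with u hu
    have : 0 ≤ K + u := by linarith
    positivity
  · filter_upwards [Filter.eventually_ge_atTop (-K), Filter.eventually_ge_atTop 1] with u hu hu1
    have : 0 ≤ K + u := by linarith
    have e : Real.exp K * (((fun x => x ^ n * Real.exp (-x)) ∘ fun x => K + id x) u)
        = (K + u) ^ n * Real.exp (-u) := by
      simp only [Function.comp, id]
      rw [mul_left_comm, ← Real.exp_add]
      congr 2
      ring
    rw [e]
    gcongr
    nlinarith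

/-- On a region closed in `{P ≠ 0}`, the function `P² exp (-∑ (x_j + a_j)²)` has a critical
point. -/
theorem exists_critical_point {ι : Type*} [Fintype ι] (P : MvPolynomial ι ℝ) (a : ι → ℝ)
    {U : Set (ι → ℝ)} (hU : IsOpen U) (hne : U.Nonempty) (hUP : ∀ x ∈ U, eval x P ≠ 0)
    (hcl : ∀ x ∈ closure U, eval x P ≠ 0 → x ∈ U) :
    ∃ x ∈ U, ∀ j, eval x (pderiv j P) - x j * eval x P = a j * eval x P := by
  classical
  set h : (ι → ℝ) → ℝ := fun x => eval x P ^ 2 * Real.exp (-∑ j, (x j + a j) ^ 2) with hh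
  have hcont : Continuous h := by
    have := P.continuous_eval
    fun_prop
  have hlim : Filter.Tendsto h (Filter.cocompact _) (nhds 0) := by
    obtain ⟨C, n, hC, hb⟩ := exists_abs_eval_le P
    have hu : Filter.Tendsto (fun x : ι → ℝ => ‖x + a‖) (Filter.cocompact _) Filter.atTop :=
      (tendsto_norm_cocompact_atTop (E := ι → ℝ)).comp
        (Homeomorph.addRight a).isClosedEmbedding.tendsto_cocompact
    have := ((tendsto_add_pow_mul_exp_neg_sq (1 + ‖a‖) (n * 2)).comp hu).const_mul (C ^ 2)
    rw [mul_zero] at this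
    refine squeeze_zero (fun x => by positivity) (fun x => ?_) this
    have h1 : eval x P ^ 2 ≤ C ^ 2 * (1 + ‖a‖ + ‖x + a‖) ^ (n * 2) := by
      have hx : ‖x‖ ≤ ‖a‖ + ‖x + a‖ := by
        calc ‖x‖ = ‖(x + a) - a‖ := by simp
          _ ≤ _ := by rw [add_comm ‖a‖]; exact norm_sub_le _ _
      calc eval x P ^ 2 = |eval x P| ^ 2 := (sq_abs _).symm
        _ ≤ (C * (1 + ‖x‖) ^ n) ^ 2 := by gcongr; exact hb x
        _ = C ^ 2 * (1 + ‖x‖) ^ (n * 2) := by rw [mul_pow, pow_mul]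
        _ ≤ _ := by
          refine mul_le_mul_of_nonneg_left (pow_le_pow_left₀ (by positivity) ?_ _) (by positivity)
          linarith
    have h2 : ‖x + a‖ ^ 2 ≤ ∑ j, (x j + a j) ^ 2 := by
      rw [← Real.le_sqrt (norm_nonneg _) (by positivity)]
      refine (pi_norm_le_iff_of_nonneg (by positivity)).2 fun i => ?_
      refine Real.le_sqrt_of_sq_le ?_
      rw [Real.norm_eq_abs, sq_abs]
      exact Finset.single_le_sum (f := fun j => (x j + a j) ^ 2) (fun j _ => by positivity)
        (Finset.mem_univ i)
    simp only [Function.comp, hh, ← mul_assoc]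
    gcongr
  obtain ⟨x₀, hx₀⟩ := hne
  have hpos : ∀ x, eval x P ≠ 0 → 0 < h x := fun x hx => by positivity
  obtain ⟨x, hxU, hmax⟩ := hcont.continuousOn.exists_isMaxOn' isClosed_closure (subset_closure hx₀)
    (Filter.Eventually.filter_mono inf_le_left
      ((hlim.eventually_lt_const (hpos x₀ (hUP x₀ hx₀))).mono fun _ => le_of_lt))
  have hx : x ∈ U := by
    refine hcl x hxU fun h0 => ?_
    have h3 := hmax (subset_closure hx₀)
    have h4 := hpos x₀ (hUP x₀ hx₀)
    have h5 : h x = 0 := by simp [hh, h0]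
    simp only [Set.mem_ofPred_eq] at h3
    linarith
  refine ⟨x, hx, fun j => ?_⟩
  have hloc : IsLocalMax h x := (hmax.on_subset subset_closure).isLocalMax (hU.mem_nhds hx)
  have hloc' : IsLocalMax (fun t => h (Function.update x j t)) (x j) := by
    have hc : Filter.Tendsto (fun t => Function.update x j t) (nhds (x j)) (nhds x) := by
      have : Continuous (fun t => Function.update x j t) := by fun_prop
      simpa using this.tendsto (x j)
    have := hc.eventually hloc
    simpa [IsLocalMax, IsMaxFilter] using this
  have hd := (hasDerivAt_eval_update P x j).fun_pow 2
  have he : HasDerivAt (fun t => -∑ i, (Function.update x j t i + a i) ^ 2)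
      (-(2 * (x j + a j))) (x j) := by
    refine HasDerivAt.fun_neg ?_
    have : ∀ i ∈ Finset.univ, HasDerivAt (fun t => (Function.update x j t i + a i) ^ 2)
        (if i = j then 2 * (x j + a j) else 0) (x j) := by
      intro i _
      rcases eq_or_ne i j with rfl | hij
      · simpa using ((hasDerivAt_id (x i)).add_const (a i)).fun_pow 2
      · simpa [hij] using hasDerivAt_const _ _
    simpa using HasDerivAt.fun_sum this
  have h0 := hloc'.hasDerivAt_eq_zero (hd.fun_mul he.exp)
  have hP := hUP x hx
  simp only [Function.update_eq_self, Nat.cast_ofNat, Nat.add_one_sub_one, pow_one] at h0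
  have hexp := Real.exp_ne_zero (-∑ i, (x i + a i) ^ 2)
  have h6 : 2 * eval x P * Real.exp (-∑ i, (x i + a i) ^ 2) *
      (eval x (pderiv j P) - x j * eval x P - a j * eval x P) = 0 := by
    linear_combination h0
  have h7 : 2 * eval x P * Real.exp (-∑ i, (x i + a i) ^ 2) ≠ 0 := by positivity
  linear_combination (mul_eq_zero.1 h6).resolve_left h7
/-- If `P ≠ 0` at `x` and `∇P / P - x = a` there, with `a` generic, then the value of a given
affine form at `x` is a root of a nonzero polynomial of controlled degree. -/
theorem exists_generic_root_bound {ι : Type*} [Fintype ι] (P : MvPolynomial ι ℝ) {E : ℕ}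
    (hP : P.totalDegree ≤ E) (l : MvPolynomial ι ℝ) (hl : l.totalDegree ≤ 1) :
    ∃ R : MvPolynomial ι ℝ, R ≠ 0 ∧ ∀ a, eval a R ≠ 0 → ∃ f : Polynomial ℝ, f ≠ 0 ∧
      f.natDegree ≤ (1 + Fintype.card ι * (E + 1)) ^ Fintype.card ι ∧
      ∀ x, eval x P ≠ 0 →
        (∀ j, eval x (pderiv j P) - x j * eval x P = a j * eval x P) →
        f.eval (eval x l) = 0 := by
  classical
  set N := Fintype.card ι with hN
  set A := (1 + N * (E + 1)) ^ N with hA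
  set B := A + 1 with hB
  set T := B * (1 + N * (E + 1)) with hT
  let expo : (ι → Fin B) → ι →₀ ℕ := fun β => Finsupp.equivFunOnFinite.symm fun i => (β i : ℕ)
  let m : Fin B × (ι → Fin B) → MvPolynomial ι ℝ := fun p =>
    l ^ (p.1 : ℕ) * (∏ j, (pderiv j P - X j * P) ^ (p.2 j : ℕ)) *
      P ^ (N * B - ∑ j, (p.2 j : ℕ))
  have hsum : ∀ β : ι → Fin B, ∑ j, (β j : ℕ) ≤ N * B := fun β => by
    calc ∑ j, (β j : ℕ) ≤ ∑ _j : ι, B := Finset.sum_le_sum fun j _ => (β j).2.le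
      _ = N * B := by simp [hN]
  have hdeg : ∀ p, (m p).totalDegree < T := by
    intro p
    have h1 : (l ^ (p.1 : ℕ)).totalDegree ≤ p.1 :=
      (totalDegree_pow _ _).trans (by simpa using Nat.mul_le_mul_left (p.1 : ℕ) hl)
    have h2 : (∏ j, (pderiv j P - X j * P) ^ (p.2 j : ℕ)).totalDegree ≤
        (E + 1) * ∑ j, (p.2 j : ℕ) := by
      refine (totalDegree_finsetProd _ _).trans ?_
      rw [Finset.mul_sum]
      refine Finset.sum_le_sum fun j _ => (totalDegree_pow _ _).trans ?_
      rw [mul_comm]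
      refine Nat.mul_le_mul_right _ ((totalDegree_sub _ _).trans (max_le ?_ ?_))
      · exact (totalDegree_pderiv_le j P).trans (hP.trans (Nat.le_succ E))
      · refine (totalDegree_mul _ _).trans ?_
        rw [totalDegree_X]
        omega
    have h3 : (P ^ (N * B - ∑ j, (p.2 j : ℕ))).totalDegree ≤
        (E + 1) * (N * B - ∑ j, (p.2 j : ℕ)) := by
      refine (totalDegree_pow _ _).trans ?_
      rw [mul_comm]
      exact Nat.mul_le_mul_right _ (hP.trans (Nat.le_succ E))
    calc (m p).totalDegree ≤ _ := totalDegree_mul _ _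
      _ ≤ _ := Nat.add_le_add ((totalDegree_mul _ _).trans (Nat.add_le_add h1 h2)) h3
      _ = p.1 + (E + 1) * (N * B) := by
        rw [add_assoc, ← mul_add, Nat.add_sub_cancel' (hsum p.2)]
      _ < B + (E + 1) * (N * B) := Nat.add_lt_add_right p.1.2 _
      _ = T := by rw [hT]; ring
  let L : (Fin B × (ι → Fin B) → ℝ) →ₗ[ℝ] ((ι → Fin T) → ℝ) :=
    LinearMap.pi fun γ =>
      (lcoeff ℝ (Finsupp.equivFunOnFinite.symm fun i => (γ i : ℕ))) ∘ₗ
        Fintype.linearCombination ℝ m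
  have hker : LinearMap.ker L ≠ ⊥ := by
    apply LinearMap.ker_ne_bot_of_finrank_lt
    simp only [Module.finrank_fintype_fun_eq_card, Fintype.card_prod, Fintype.card_fun,
      Fintype.card_fin, ← hN]
    rw [hT, mul_pow, mul_comm B]
    exact Nat.mul_lt_mul_of_pos_left (Nat.lt_succ_self A) (by positivity)
  obtain ⟨q, hqL, hq0⟩ := (Submodule.ne_bot_iff _).1 hker
  have hrel : ∑ p, q p • m p = 0 := by
    ext γ
    rw [coeff_zero]
    by_cases hγ : ∀ i, γ i < T
    · have := congrFun (LinearMap.mem_ker.1 hqL) fun i => ⟨γ i, hγ i⟩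
      simpa [L, Fintype.linearCombination_apply, coeff_sum] using this
    · push Not at hγ
      obtain ⟨i, hi⟩ := hγ
      refine coeff_eq_zero_of_totalDegree_lt (lt_of_lt_of_le ?_ (Finsupp.le_degree i γ))
      refine lt_of_lt_of_le ?_ hi
      have hT0 : 0 < T := by positivity
      refine lt_of_le_of_lt (totalDegree_finsetSum_le (d := T - 1) fun p _ => ?_) (by omega)
      have := (totalDegree_smul_le (q p) (m p)).trans_lt (hdeg p)
      omega
  obtain ⟨⟨α₀, β₀⟩, hq⟩ := Function.ne_iff.1 hq0
  have hexpo : Function.Injective expo := fun β β' h => by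
    funext i
    exact Fin.ext (DFunLike.congr_fun h i)
  have heval : ∀ (a : ι → ℝ) (α : Fin B), eval a (∑ β, monomial (expo β) (q (α, β))) =
      ∑ β, q (α, β) * ∏ j, a j ^ (β j : ℕ) := fun a α => by
    rw [map_sum]
    refine Finset.sum_congr rfl fun β _ => ?_
    rw [eval_monomial, Finsupp.prod_fintype _ _ (by simp)]
    rfl
  refine ⟨∑ β, monomial (expo β) (q (α₀, β)), fun h0 => hq ?_, fun a ha => ?_⟩
  · have := congrArg (coeff (expo β₀)) h0
    simpa [coeff_sum, coeff_monomial, hexpo.eq_iff] using this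
  · let c : Fin B → ℝ := fun α => ∑ β, q (α, β) * ∏ j, a j ^ (β j : ℕ)
    refine ⟨∑ α : Fin B, Polynomial.monomial (α : ℕ) (c α), fun h0 => ha ?_, ?_,
      fun x hx hcrit => ?_⟩
    · rw [heval]
      have := congrArg (fun f => Polynomial.coeff f α₀) h0
      simpa [Polynomial.finsetSum_coeff, Polynomial.coeff_monomial, Fin.val_inj] using this
    · refine Polynomial.natDegree_sum_le_of_forall_le _ _ fun α _ => ?_
      exact (Polynomial.natDegree_monomial_le _).trans (Nat.lt_succ_iff.1 α.2)
    · have hm : ∀ p, eval x (m p) =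
          eval x P ^ (N * B) * ((∏ j, a j ^ (p.2 j : ℕ)) * eval x l ^ (p.1 : ℕ)) := by
        intro p
        simp only [m, map_mul, map_pow, map_prod, map_sub, eval_X, hcrit, mul_pow,
          Finset.prod_mul_distrib, Finset.prod_pow_eq_pow_sum]
        rw [← Nat.sub_add_cancel (hsum p.2), pow_add, Nat.sub_add_cancel (hsum p.2)]
        ring
      have h := congrArg (eval x) hrel
      simp only [map_sum, smul_eval, hm, map_zero] at h
      have h' : eval x P ^ (N * B) *
          ∑ α : Fin B, c α * eval x l ^ (α : ℕ) = 0 := by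
        rw [← h, Fintype.sum_prod_type, Finset.mul_sum]
        refine Finset.sum_congr rfl fun α _ => ?_
        simp only [c, Finset.sum_mul, Finset.mul_sum]
        exact Finset.sum_congr rfl fun β _ => by ring
      simpa [Polynomial.eval_finsetSum] using
        (mul_eq_zero.1 h').resolve_left (pow_ne_zero _ hx)


/-- A nonzero polynomial of degree at most `E` has few pairwise disjoint open regions that are
relatively closed in its nonvanishing locus. -/
theorem card_regions_le {ι S : Type*} [Fintype ι] [Finite S] (P : MvPolynomial ι ℝ) {E : ℕ}
    (hP : P.totalDegree ≤ E) (U : S → Set (ι → ℝ)) (hU : ∀ s, IsOpen (U s))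
    (hne : ∀ s, (U s).Nonempty) (hUP : ∀ s, ∀ x ∈ U s, eval x P ≠ 0)
    (hcl : ∀ s, ∀ x ∈ closure (U s), eval x P ≠ 0 → x ∈ U s)
    (hdisj : ∀ s t x, x ∈ U s → x ∈ U t → s = t) :
    Nat.card S ≤ (1 + Fintype.card ι * (E + 1)) ^ Fintype.card ι := by
  classical
  have := Fintype.ofFinite S
  let e := Fintype.equivFin ι
  let l : ℕ → MvPolynomial ι ℝ := fun t => ∑ j, C ((t : ℝ) ^ (e j : ℕ)) * X j
  have hl : ∀ t, (l t).totalDegree ≤ 1 := fun t =>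
    totalDegree_finsetSum_le fun j _ => (totalDegree_mul _ _).trans (by
      rw [totalDegree_C, totalDegree_X])
  choose R hR0 hR using fun t => exists_generic_root_bound P hP (l t) (hl t)
  obtain ⟨a, ha⟩ := (dense_iInter_of_isOpen (fun t => isOpen_eval_ne_zero (R t))
    fun t => dense_eval_ne_zero (hR0 t)).nonempty
  simp only [Set.mem_iInter, Set.mem_ofPred_eq] at ha
  choose x hxU hx using fun s => exists_critical_point P a (hU s) (hne s) (hUP s) (hcl s)
  let g : S × S → Polynomial ℝ := fun p =>
    ∑ j, Polynomial.monomial (e j : ℕ) (x p.1 j - x p.2 j)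
  have hg : ∀ p, p.1 ≠ p.2 → g p ≠ 0 := by
    rintro ⟨s, t⟩ hst h0
    refine hst (hdisj s t (x s) (hxU s) ?_)
    convert hxU t using 1
    funext j
    have := congrArg (fun f => Polynomial.coeff f (e j)) h0
    simpa [g, Polynomial.finsetSum_coeff, Polynomial.coeff_monomial, Fin.val_inj,
      sub_eq_zero] using this
  have hG : ∏ p : S × S with p.1 ≠ p.2, g p ≠ 0 :=
    Finset.prod_ne_zero_iff.2 fun p hp => hg p (Finset.mem_filter.1 hp).2
  obtain ⟨t, ht⟩ : ∃ t : ℕ, (∏ p : S × S with p.1 ≠ p.2, g p).eval (t : ℝ) ≠ 0 := by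
    by_contra! h
    refine hG (Polynomial.eq_zero_of_infinite_isRoot _
      ((Set.infinite_range_of_injective (Nat.cast_injective (R := ℝ))).mono ?_))
    rintro _ ⟨t, rfl⟩
    exact h t
  have hinj : Function.Injective fun s => eval (x s) (l t) := by
    intro s s' hss
    by_contra hne'
    rw [Polynomial.eval_prod] at ht
    refine Finset.prod_ne_zero_iff.1 ht (s, s') (by simpa using hne') ?_
    have : eval (x s) (l t) - eval (x s') (l t) = 0 := sub_eq_zero.2 hss
    rw [← this]
    simp only [g, l, Polynomial.eval_finsetSum, Polynomial.eval_monomial, map_sum, map_mul,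
      eval_C, eval_X, ← Finset.sum_sub_distrib]
    exact Finset.sum_congr rfl fun j _ => by ring
  obtain ⟨f, hf0, hfdeg, hf⟩ := hR t a (ha t)
  rw [Nat.card_eq_fintype_card, ← Finset.card_univ, ← Finset.card_image_of_injective _ hinj]
  refine (Finset.card_le_card (t := f.roots.toFinset) ?_).trans
    ((Multiset.toFinset_card_le _).trans ((Polynomial.card_roots' f).trans hfdeg))
  intro y hy
  obtain ⟨s, -, rfl⟩ := Finset.mem_image.1 hy
  simpa [hf0] using hf (x s) (hUP s _ (hxU s)) (hx s)

/-- Where the trailing coefficient of a polynomial relation satisfied by a continuous function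
does not vanish, the zero set of the function is open. -/
theorem eventually_eq_zero_of_trailingCoeff_ne_zero {ι : Type*}
    (Q : Polynomial (MvPolynomial ι ℝ)) {g : (ι → ℝ) → ℝ} (hg : Continuous g)
    (hQ : ∀ y, Q.eval₂ (eval y) (g y) = 0) {x : ι → ℝ} (hx : eval x Q.trailingCoeff ≠ 0)
    (h0 : g x = 0) : ∀ᶠ y in nhds x, g y = 0 := by
  obtain ⟨q, hq⟩ : Polynomial.X ^ Q.natTrailingDegree ∣ Q :=
    Polynomial.X_pow_dvd_iff.2 fun _ => Polynomial.coeff_eq_zero_of_lt_natTrailingDegree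
  have hq0 : q.coeff 0 = Q.trailingCoeff := by
    have h := congrArg (fun f => Polynomial.coeff f Q.natTrailingDegree) hq
    simp only [Polynomial.coeff_X_pow_mul', le_refl, if_true, Nat.sub_self] at h
    exact h.symm
  have hcont : Continuous fun y => q.eval₂ (eval y) (g y) := by
    simp only [Polynomial.eval₂_eq_sum_range]
    exact continuous_finsetSum _ fun i _ => (q.coeff i).continuous_eval.mul (hg.pow i)
  have hne : q.eval₂ (eval x) (g x) ≠ 0 := by
    rwa [h0, Polynomial.eval₂_at_zero, hq0]
  filter_upwards [hcont.continuousAt.eventually_ne hne] with y hy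
  have := hQ y
  rw [hq, Polynomial.eval₂_mul, Polynomial.eval₂_X_pow] at this
  exact eq_zero_of_pow_eq_zero ((mul_eq_zero.1 this).resolve_right hy)

/-- The ring homomorphism sending a polynomial to its evaluation function. -/
noncomputable def evalFunction (σ : Type*) : MvPolynomial σ ℝ →+* ((σ → ℝ) → ℝ) :=
  RingHom.pi fun z => eval z

/-- Specializing some variables of a continuous function integral over polynomials: the
specializations have relatively open zero sets off hypersurfaces of bounded degree. -/
theorem exists_degree_bound_of_isIntegralElem {τ ι : Type*} {F : (τ ⊕ ι → ℝ) → ℝ}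
    (hF : Continuous F) (hFint : (evalFunction (τ ⊕ ι)).IsIntegralElem F) :
    ∃ D : ℕ, ∀ w : τ → ℝ, ∃ p : MvPolynomial ι ℝ, p ≠ 0 ∧ p.totalDegree ≤ D ∧
      ∀ x, eval x p ≠ 0 → F (Sum.elim w x) = 0 →
        ∀ᶠ y in nhds x, F (Sum.elim w y) = 0 := by
  obtain ⟨Q, hmonic, hQ⟩ := hFint
  refine ⟨Q.support.sup fun i => (Q.coeff i).totalDegree, fun w => ?_⟩
  let s : MvPolynomial (τ ⊕ ι) ℝ →+* MvPolynomial ι ℝ :=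
    (aeval (Sum.elim (fun i => C (w i)) X)).toRingHom
  have hs : ∀ y, (eval y).comp s = eval (Sum.elim w y) := fun y => by
    refine MvPolynomial.ringHom_ext (fun r => by simp [s]) fun i => ?_
    cases i <;> simp [s]
  refine ⟨(Q.map s).trailingCoeff,
    Polynomial.trailingCoeff_nonzero_iff_nonzero.2 (hmonic.map s).ne_zero, ?_,
    fun x hx h0 => eventually_eq_zero_of_trailingCoeff_ne_zero (Q.map s)
      (g := fun y => F (Sum.elim w y)) (hF.comp ?_) (fun y => ?_) hx h0⟩
  · rw [Polynomial.trailingCoeff, Polynomial.coeff_map]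
    refine (totalDegree_aeval_le_of_totalDegree_le_one _ (fun i => ?_) _).trans ?_
    · cases i <;> simp
    · by_cases hi : (Q.map s).natTrailingDegree ∈ Q.support
      · exact Finset.le_sup (f := fun i => (Q.coeff i).totalDegree) hi
      · simp [Polynomial.notMem_support_iff.1 hi]
  · exact continuous_pi fun i => by cases i <;> simp <;> fun_prop
  · rw [Polynomial.eval₂_map, hs]
    have := congrFun hQ (Sum.elim w y)
    have h2 := Polynomial.hom_eval₂ Q (evalFunction (τ ⊕ ι))
      (Pi.evalRingHom (fun _ => ℝ) (Sum.elim w y)) F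
    exact h2.symm.trans this

theorem isIntegralElem_sqrt {σ : Type*} (q : MvPolynomial σ ℝ) (hq : ∀ z, 0 ≤ eval z q) :
    (evalFunction σ).IsIntegralElem fun z => √(eval z q) := by
  refine ⟨Polynomial.X ^ 2 - Polynomial.C q, Polynomial.monic_X_pow_sub_C q two_ne_zero, ?_⟩
  funext z
  have : evalFunction σ q z = eval z q := rfl
  simp [Polynomial.eval₂_sub, Real.sq_sqrt (hq z), this]

/-- The sum of distances from `c` to the `k` vantage points with coordinates `x`. -/
noncomputable def coordSumDist {d k : ℕ} (c : Fin d → ℝ) (x : Fin k × Fin d → ℝ) : ℝ :=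
  ∑ l, √(∑ j, (c j - x (l, j)) ^ 2)

theorem continuous_coordSumDist {d k : ℕ} :
    Continuous fun p : (Fin d → ℝ) × (Fin k × Fin d → ℝ) => coordSumDist p.1 p.2 := by
  unfold coordSumDist
  fun_prop

theorem isIntegralElem_coordSumDist {d k : ℕ} {τ : Type*} (u : Fin d → τ) :
    (evalFunction (τ ⊕ (Fin k × Fin d))).IsIntegralElem
      fun z => coordSumDist (fun j => z (.inl (u j))) fun i => z (.inr i) := by
  have h : ∀ s : Finset (Fin k), (evalFunction (τ ⊕ (Fin k × Fin d))).IsIntegralElem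
      fun z => ∑ l ∈ s, √(∑ j, (z (.inl (u j)) - z (.inr (l, j))) ^ 2) := by
    classical
    intro s
    induction s using Finset.induction_on with
    | empty =>
      simp only [Finset.sum_empty]
      exact (evalFunction (τ ⊕ (Fin k × Fin d))).isIntegralElem_zero
    | insert l s hl ih =>
      have := isIntegralElem_sqrt (σ := τ ⊕ (Fin k × Fin d))
        (∑ j, (X (.inl (u j)) - X (.inr (l, j))) ^ 2) fun z => by
          simp only [map_sum, map_pow]; positivity
      simp only [Finset.sum_insert hl]
      simp only [map_sum, map_pow, map_sub, eval_X] at this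
      exact this.add _ ih
  exact h Finset.univ

theorem exists_degree_bound_coordSumDist (d k : ℕ) :
    ∃ D : ℕ, ∀ c c' : Fin d → ℝ, ∃ p : MvPolynomial (Fin k × Fin d) ℝ,
      p ≠ 0 ∧ p.totalDegree ≤ D ∧ ∀ x, eval x p ≠ 0 → coordSumDist c x = coordSumDist c' x →
        ∀ᶠ y in nhds x, coordSumDist c y = coordSumDist c' y := by
  have hc : ∀ u : Fin d → Fin d ⊕ Fin d, Continuous
      fun z : (Fin d ⊕ Fin d) ⊕ (Fin k × Fin d) → ℝ =>
        coordSumDist (fun j => z (.inl (u j))) fun i => z (.inr i) := fun u =>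
    continuous_coordSumDist.comp (f := fun z : (Fin d ⊕ Fin d) ⊕ (Fin k × Fin d) → ℝ =>
      (fun j => z (.inl (u j)), fun i => z (.inr i))) (by fun_prop)
  obtain ⟨D, hD⟩ := exists_degree_bound_of_isIntegralElem ((hc .inl).sub (hc .inr))
    ((isIntegralElem_coordSumDist (k := k) (Sum.inl : Fin d → Fin d ⊕ Fin d)).sub _
      (isIntegralElem_coordSumDist (k := k) (Sum.inr : Fin d → Fin d ⊕ Fin d)))
  refine ⟨D, fun c c' => ?_⟩
  obtain ⟨p, hp, hdeg, h⟩ := hD (Sum.elim c c')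
  refine ⟨p, hp, hdeg, fun x hx hxe => ?_⟩
  simpa [sub_eq_zero] using h x hx (by simpa [sub_eq_zero] using hxe)

theorem sumDist_map_toLp {d k : ℕ} (x : Fin k × Fin d → ℝ) (c : EuclideanSpace ℝ (Fin d)) :
    sumDist (Finset.univ.val.map fun l => WithLp.toLp 2 fun j => x (l, j)) c =
      coordSumDist (fun j => c j) x := by
  simp [sumDist, coordSumDist, EuclideanSpace.dist_eq, Real.dist_eq, List.sum_ofFn]

theorem exists_coordSumDist_eq {d k : ℕ} (V : Multiset (EuclideanSpace ℝ (Fin d)))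
    (hV : Multiset.card V = k) :
    ∃ x : Fin k × Fin d → ℝ, ∀ c, sumDist V c = coordSumDist (fun j => c j) x := by
  subst hV
  induction V using Quotient.inductionOn with
  | h L =>
    refine ⟨fun i => L.get i.1 i.2, fun c => ?_⟩
    rw [← sumDist_map_toLp]
    congr 1
    have h : Finset.univ.val.map L.get = (L : Multiset (EuclideanSpace ℝ (Fin d))) := by
      simp [Fin.univ_val_map]
    exact h.symm

theorem psiCount_le {d k D : ℕ}
    (hD : ∀ c c' : Fin d → ℝ, ∃ p : MvPolynomial (Fin k × Fin d) ℝ,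
      p ≠ 0 ∧ p.totalDegree ≤ D ∧ ∀ x, eval x p ≠ 0 → coordSumDist c x = coordSumDist c' x →
        ∀ᶠ y in nhds x, coordSumDist c y = coordSumDist c' y)
    (C : Finset (EuclideanSpace ℝ (Fin d))) :
    psiCount k C ≤ (1 + k * d * (C.card ^ 2 * D + 1)) ^ (k * d) := by
  classical
  choose p hp0 hpdeg hp using hD
  let P := ∏ q ∈ C ×ˢ C, p (fun j => q.1 j) (fun j => q.2 j)
  have hPdeg : P.totalDegree ≤ C.card ^ 2 * D := by
    refine (totalDegree_finsetProd _ _).trans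
      ((Finset.sum_le_card_nsmul _ _ D fun q _ => hpdeg _ _).trans ?_)
    simp [sq]
  have hP0 : P ≠ 0 := Finset.prod_ne_zero_iff.2 fun q _ => hp0 _ _
  have hPp : ∀ x, eval x P ≠ 0 → ∀ c ∈ C, ∀ c' ∈ C,
      eval x (p (fun j => c j) fun j => c' j) ≠ 0 := fun x hx c hc c' hc' => by
    simp only [P, map_prod] at hx
    exact Finset.prod_ne_zero_iff.1 hx (c, c') (Finset.mk_mem_product hc hc')
  have hcont : ∀ c : EuclideanSpace ℝ (Fin d),
      Continuous fun x : Fin k × Fin d → ℝ => coordSumDist (fun j => c j) x := fun c => by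
    unfold coordSumDist
    fun_prop
  let M : (Fin C.card → EuclideanSpace ℝ (Fin d)) → Set (Fin k × Fin d → ℝ) := fun σ =>
    {x | StrictMono fun i => coordSumDist (fun j => σ i j) x}
  have hM : ∀ σ, IsOpen (M σ) := fun σ => by
    have : M σ = ⋂ i, ⋂ j, ⋂ _ : i < j,
        {x | coordSumDist (fun m => σ i m) x < coordSumDist (fun m => σ j m) x} := by
      ext x
      simp [M, StrictMono]
    rw [this]
    exact isOpen_iInter_of_finite fun i => isOpen_iInter_of_finite fun j =>
      isOpen_iInter_of_finite fun _ => isOpen_lt (hcont _) (hcont _)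
  have hfin : Finite (PsiSet k C.card C) :=
    ((Set.Finite.pi' fun _ => C.finite_toSet).subset fun σ hσ => hσ.2.1).to_subtype
  have key := card_regions_le (S := PsiSet k C.card C) P hPdeg
    (fun σ => M σ ∩ {x | eval x P ≠ 0}) (fun σ => (hM σ).inter (isOpen_eval_ne_zero P))
    ?_ (fun σ x hx => hx.2) ?_ ?_
  · simpa [psiCount] using key
  · rintro ⟨σ, -, -, V, hV, -, hmono⟩
    obtain ⟨x, hx⟩ := exists_coordSumDist_eq V hV
    refine (dense_eval_ne_zero hP0).inter_open_nonempty _ (hM σ) ⟨x, ?_⟩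
    simpa [M, hx] using hmono
  · rintro ⟨σ, _, hσC, _⟩ x hx hxP
    refine ⟨fun i j hij => lt_of_le_of_ne ?_ fun heq => ?_, hxP⟩
    · exact closure_minimal (fun y hy => (hy.1 hij).le) (isClosed_le (hcont _) (hcont _)) hx
    · have hev := hp _ _ x (hPp x hxP _ (hσC i) _ (hσC j)) heq
      obtain ⟨y, hy, hye⟩ := ((mem_closure_iff_frequently.1 hx).and_eventually hev).exists
      exact (hy.1 hij).ne hye
  · rintro ⟨σ, hσ, hσC, _⟩ ⟨τ, hτ, hτC, _⟩ x hxσ hxτ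
    have hrange : ∀ {ρ : Fin C.card → EuclideanSpace ℝ (Fin d)}, Function.Injective ρ →
        (∀ i, ρ i ∈ C) → Set.range ρ = C := fun {ρ} hρ hρC => by
      have : Finset.univ.image ρ = C := Finset.eq_of_subset_of_card_le
        (Finset.image_subset_iff.2 fun i _ => hρC i)
        (by simp [Finset.card_image_of_injective _ hρ])
      simpa using congrArg (SetLike.coe : Finset (EuclideanSpace ℝ (Fin d)) → Set _) this
    have hcomp : ∀ ρ : Fin C.card → EuclideanSpace ℝ (Fin d),
        (fun i => coordSumDist (fun j => ρ i j) x) =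
          (fun c : EuclideanSpace ℝ (Fin d) => coordSumDist (fun j => c j) x) ∘ ρ := fun _ => rfl
    have heq := (StrictMono.range_inj hxσ.1 hxτ.1).1 (by
      rw [hcomp, hcomp, Set.range_comp, Set.range_comp, hrange hσ hσC, hrange hτ hτC])
    refine Subtype.ext (funext fun i => ?_)
    obtain ⟨j, hj⟩ : τ i ∈ Set.range σ := by
      rw [hrange hσ hσC]
      exact hτC i
    have h1 := congrFun heq i
    simp only [← hj] at h1
    exact (congrArg σ (hxσ.1.injective h1)).trans hj

/-- For all `d ≥ 1` and `k ≥ 1`, there is a constant `c` (depending only on `d,k`)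
such that `ψ^max_{d,k}(n) ≤ c · n^{2dk}` for all positive integers `n`. -/
theorem psiMax_upper (d k : ℕ) (hd : 1 ≤ d) (hk : 1 ≤ k) :
    ∃ c : ℝ, 0 < c ∧ ∀ n : ℕ, 1 ≤ n →
      (psiMax d k n : ℝ) ≤ c * (n : ℝ) ^ (2 * d * k) := by
  obtain ⟨D, hD⟩ := exists_degree_bound_coordSumDist d k
  refine ⟨((1 + k * d * (D + 1)) ^ (k * d) : ℕ), by positivity, fun n hn => ?_⟩
  suffices h : psiMax d k n ≤ (1 + k * d * (D + 1)) ^ (k * d) * n ^ (2 * d * k) by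
    exact_mod_cast h
  refine csSup_le' ?_
  rintro m ⟨C, rfl, rfl⟩
  refine (psiCount_le hD C).trans ?_
  rw [mul_assoc 2 d k, mul_comm d k, pow_mul _ 2, ← mul_pow]
  refine Nat.pow_le_pow_left ?_ _
  have : 1 ≤ C.card ^ 2 := Nat.one_le_pow _ _ hn
  nlinarith [Nat.mul_le_mul_left (k * d) this]
end

section
/- For every even integer k ≥ 2, there is a constant c (depending only on k) such that ψ^max_{1,k}(n) ≤ c · n^{2k−2} for all positive integers n. -/
open SignType Module

lemma sign_convexCombination {a b t : ℝ} (ht : 0 < t) (ht' : t < 1) (h : sign a = sign b) :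
    sign ((1 - t) * a + t * b) = sign b := by
  have h1 : 0 < 1 - t := by linarith
  rcases lt_trichotomy b 0 with hb | hb | hb
  · rw [sign_neg hb, sign_eq_neg_one_iff] at h
    rw [sign_neg hb, sign_eq_neg_one_iff]
    nlinarith [mul_neg_of_pos_of_neg h1 h, mul_neg_of_pos_of_neg ht hb]
  · subst hb
    rw [sign_zero, sign_eq_zero_iff] at h
    simp [h]
  · rw [sign_pos hb, sign_eq_one_iff] at h
    rw [sign_pos hb, sign_eq_one_iff]
    positivity

/-- An arrangement of `N` affine hyperplanes in a `d`-dimensional real vector space has at most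
`(2 * N + 1) ^ d` faces. -/
theorem ncard_range_sign_affine_le (N : ℕ) : ∀ {E : Type*} [AddCommGroup E] [Module ℝ E]
    [FiniteDimensional ℝ E] (l : Fin N → E →ₗ[ℝ] ℝ) (c : Fin N → ℝ),
    (Set.range fun x i => sign (l i x + c i)).ncard ≤ (2 * N + 1) ^ finrank ℝ E := by
  induction N with
  | zero =>
    intro E _ _ _ l c
    simpa using Set.ncard_le_one_of_subsingleton (Set.range fun x i => sign (l i x + c i))
  | succ N ih =>
    intro E _ _ _ l c
    set S := Set.range fun x i => sign (l i x + c i) with hS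
    set T := Set.range fun (x : E) (i : Fin N) => sign (l i.succ x + c i.succ) with hT
    have hTcard : T.ncard ≤ (2 * N + 1) ^ finrank ℝ E := ih (fun i => l i.succ) _
    have hmono : (2 * N + 1) ^ finrank ℝ E ≤ (2 * (N + 1) + 1) ^ finrank ℝ E :=
      Nat.pow_le_pow_left (by omega) _
    by_cases h0 : l 0 = 0
    · refine le_trans ?_ (hTcard.trans hmono)
      refine Set.ncard_le_ncard_of_injOn Fin.tail ?_ ?_ (Set.toFinite _)
      · rintro _ ⟨x, rfl⟩
        exact ⟨x, rfl⟩
      · rintro _ ⟨x, rfl⟩ _ ⟨y, rfl⟩ hxy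
        funext i
        refine Fin.cases ?_ (fun j => congrFun hxy j) i
        simp [h0]
    · obtain ⟨x₀, hx₀⟩ := LinearMap.surjective h0 (-c 0)
      let P : SignType → Set (Fin N → SignType) := fun s =>
        {τ | ∃ x, sign (l 0 x + c 0) = s ∧ τ = fun i => sign (l i.succ x + c i.succ)}
      have hunion : S ⊆ Fin.cons (α := fun _ => SignType) 0 '' P 0 ∪
          (Fin.cons (α := fun _ => SignType) 1 '' P 1 ∪
            Fin.cons (α := fun _ => SignType) (-1) '' P (-1)) := by
        rintro _ ⟨x, rfl⟩
        have key : (fun i => sign (l i x + c i)) ∈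
            Fin.cons (α := fun _ => SignType) (sign (l 0 x + c 0)) '' P (sign (l 0 x + c 0)) := by
          refine ⟨_, ⟨x, rfl, rfl⟩, ?_⟩
          funext i
          refine Fin.cases rfl (fun j => rfl) i
        rcases hs : sign (l 0 x + c 0) with _ | _ | _ <;> rw [hs] at key
        · exact Or.inl key
        · exact Or.inr (Or.inr key)
        · exact Or.inr (Or.inl key)
      have hPT : P 1 ∪ P (-1) ⊆ T := by
        rintro _ (⟨x, -, rfl⟩ | ⟨x, -, rfl⟩) <;> exact ⟨x, rfl⟩
      have hinter : P 1 ∩ P (-1) ⊆ P 0 := by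
        rintro _ ⟨⟨x, hx, rfl⟩, ⟨y, hy, hxy⟩⟩
        rw [sign_eq_one_iff] at hx
        rw [sign_eq_neg_one_iff] at hy
        set A := l 0 x + c 0 with hA
        set B := l 0 y + c 0 with hB
        have hAB : 0 < A - B := by linarith
        have hcomb : ∀ i, l i ((1 - A / (A - B)) • x + (A / (A - B)) • y) + c i =
            (1 - A / (A - B)) * (l i x + c i) + A / (A - B) * (l i y + c i) := by
          intro i
          simp only [map_add, map_smul, smul_eq_mul]
          ring
        refine ⟨(1 - A / (A - B)) • x + (A / (A - B)) • y, ?_, ?_⟩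
        · rw [hcomb, ← hA, ← hB, sign_eq_zero_iff]
          field_simp
          ring
        · rw [hxy]
          funext i
          rw [hcomb]
          refine (sign_convexCombination (div_pos hx hAB) ?_ (congrFun hxy i)).symm
          rw [div_lt_one hAB]
          linarith
      have hdim : finrank ℝ (LinearMap.ker (l 0)) + 1 = finrank ℝ E :=
        Module.Dual.finrank_ker_add_one_of_ne_zero h0
      have hP0 : (P 0).ncard ≤ (2 * N + 1) ^ finrank ℝ (LinearMap.ker (l 0)) := by
        refine le_trans (Set.ncard_le_ncard ?_ (Set.toFinite _))
          (ih (fun i => (l i.succ).comp (LinearMap.ker (l 0)).subtype)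
            (fun i => l i.succ x₀ + c i.succ))
        rintro _ ⟨x, hx, rfl⟩
        rw [sign_eq_zero_iff] at hx
        refine ⟨⟨x - x₀, ?_⟩, ?_⟩
        · rw [LinearMap.mem_ker, map_sub, hx₀]
          linarith
        · funext i
          simp only [LinearMap.comp_apply, Submodule.subtype_apply, map_sub]
          congr 1
          ring
      have h1 := Set.ncard_le_ncard hunion (Set.toFinite _)
      have h2 := Set.ncard_union_le (Fin.cons (α := fun _ => SignType) 0 '' P 0)
          (Fin.cons (α := fun _ => SignType) 1 '' P 1 ∪
            Fin.cons (α := fun _ => SignType) (-1) '' P (-1))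
      have h3 := Set.ncard_union_le (Fin.cons (α := fun _ => SignType) 1 '' P 1)
          (Fin.cons (α := fun _ => SignType) (-1) '' P (-1))
      have h4 := fun s => Set.ncard_image_le (f := Fin.cons (α := fun _ => SignType) s)
        (Set.toFinite (P s))
      have h5 := Set.ncard_union_add_ncard_inter (P 1) (P (-1)) (Set.toFinite _) (Set.toFinite _)
      have h6 := Set.ncard_le_ncard hPT (Set.toFinite _)
      have h7 := Set.ncard_le_ncard hinter (Set.toFinite _)
      have h8 : S.ncard ≤ T.ncard + 2 * (P 0).ncard := by
        linarith [h4 0, h4 1, h4 (-1)]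
      rw [← hdim] at hTcard ⊢
      calc S.ncard ≤ (2 * N + 1) ^ (finrank ℝ (LinearMap.ker (l 0)) + 1) +
            2 * (2 * N + 1) ^ finrank ℝ (LinearMap.ker (l 0)) := by linarith
        _ = (2 * N + 1) ^ finrank ℝ (LinearMap.ker (l 0)) * (2 * (N + 1) + 1) := by ring
        _ ≤ (2 * (N + 1) + 1) ^ finrank ℝ (LinearMap.ker (l 0)) * (2 * (N + 1) + 1) := by
          gcongr
          omega
        _ = _ := by ring

theorem ncard_range_sign_affine_le_card {ι E : Type*} [Fintype ι] [AddCommGroup E] [Module ℝ E]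
    [FiniteDimensional ℝ E] (l : ι → E →ₗ[ℝ] ℝ) (c : ι → ℝ) :
    (Set.range fun x i => sign (l i x + c i)).ncard ≤
      (2 * Fintype.card ι + 1) ^ finrank ℝ E := by
  let e := Fintype.equivFin ι
  refine le_trans ?_ (ncard_range_sign_affine_le _ (fun i => l (e.symm i)) (fun i => c (e.symm i)))
  refine Set.ncard_le_ncard_of_injOn (fun f i => f (e.symm i)) ?_ ?_ (Set.toFinite _)
  · rintro _ ⟨x, rfl⟩
    exact ⟨x, rfl⟩
  · intro f _ g _ hfg
    funext i
    simpa using congrFun hfg (e i)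

/-- The middle two elements of a multiset of even cardinality in a linear order. -/
theorem Multiset.exists_middle_pair (M : Multiset ℝ) (m : ℕ) (hM : card M = 2 * m + 2) :
    ∃ (y z : ℝ) (L U : Multiset ℝ), M = y ::ₘ z ::ₘ (L + U) ∧ card L = m ∧ card U = m ∧ y ≤ z ∧
      (∀ a ∈ L, a ≤ y) ∧ ∀ a ∈ U, z ≤ a := by
  have hlen : (M.sort (· ≤ ·)).length = 2 * m + 2 := by rw [Multiset.length_sort, hM]
  have hsort : (M.sort (· ≤ ·)).Pairwise (· ≤ ·) := Multiset.pairwise_sort _ _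
  have hcoe : ((M.sort (· ≤ ·) : List ℝ) : Multiset ℝ) = M := Multiset.sort_eq _ _
  generalize M.sort (· ≤ ·) = l at hlen hsort hcoe
  have hsplit : l = l.take m ++ l[m] :: l[m + 1] :: l.drop (m + 2) := by
    rw [List.getElem_cons_drop, List.getElem_cons_drop, List.take_append_drop]
  rw [hsplit, List.pairwise_append, List.pairwise_cons, List.pairwise_cons] at hsort
  obtain ⟨-, ⟨h1, h2, -⟩, h3⟩ := hsort
  refine ⟨l[m], l[m + 1], l.take m, l.drop (m + 2), ?_, ?_, ?_, ?_, ?_, ?_⟩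
  · rw [← hcoe]
    conv_lhs => rw [hsplit]
    simp only [Multiset.coe_add, Multiset.cons_coe, Multiset.coe_eq_coe]
    exact List.perm_middle.trans (List.perm_middle.cons _)
  · simp [hlen]; omega
  · simp [hlen]; omega
  · exact h1 _ List.mem_cons_self
  · exact fun a ha => h3 a ha _ List.mem_cons_self
  · exact fun a ha => h2 a ha

theorem Multiset.exists_map_univ_eq (M : Multiset ℝ) (m : ℕ) (hM : card M = m) :
    ∃ r : Fin m → ℝ, (Finset.univ.val.map r) = M := by
  induction M using Quotient.inductionOn with
  | h l =>
    subst hM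
    exact ⟨l.get, (Fin.univ_val_map l.get).trans (congrArg _ (List.ofFn_get l))⟩

/-- The weighted sum of distances from `x` to the coordinates of `u`, the distinguished
coordinate `none` counting twice. -/
noncomputable def foldedDist {q : ℕ} (u : Option (Fin q) → ℝ) (x : ℝ) : ℝ :=
  ∑ a, a.elim 2 (fun _ => 1) * |x - u a|

lemma sumDist_fin_one (V : Multiset (EuclideanSpace ℝ (Fin 1))) (x : EuclideanSpace ℝ (Fin 1)) :
    sumDist V x = ((V.map fun v => v 0).map fun t => |x 0 - t|).sum := by
  rw [sumDist, Multiset.map_map]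
  congr 1
  refine Multiset.map_congr rfl fun v _ => ?_
  simp [EuclideanSpace.dist_eq, Real.dist_eq, Real.sqrt_sq_eq_abs]

lemma sum_map_abs_sub_le (L U : Multiset ℝ) (h : L.card = U.card) {s t : ℝ}
    (hL : ∀ a ∈ L, a ≤ s) (hU : ∀ a ∈ U, s ≤ a) :
    ((L + U).map fun a => |s - a|).sum ≤ ((L + U).map fun a => |t - a|).sum := by
  have hs : ((L + U).map fun a => |s - a|).sum = U.sum - L.sum := by
    have h1 : (L.map fun a => |s - a|) = L.map fun a => s - a :=
      Multiset.map_congr rfl fun a ha => abs_of_nonneg (by linarith [hL a ha])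
    have h2 : (U.map fun a => |s - a|) = U.map fun a => a - s :=
      Multiset.map_congr rfl fun a ha => by rw [abs_sub_comm, abs_of_nonneg (by linarith [hU a ha])]
    rw [Multiset.map_add, Multiset.sum_add, h1, h2, Multiset.sum_map_sub, Multiset.sum_map_sub]
    simp [h]
  have ht : U.sum - L.sum ≤ ((L + U).map fun a => |t - a|).sum := by
    have h1 : (L.map fun a => t - a).sum ≤ (L.map fun a => |t - a|).sum :=
      Multiset.sum_map_le_sum_map _ _ fun a _ => le_abs_self _
    have h2 : (U.map fun a => a - t).sum ≤ (U.map fun a => |t - a|).sum :=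
      Multiset.sum_map_le_sum_map _ _ fun a _ => by rw [abs_sub_comm]; exact le_abs_self _
    rw [Multiset.sum_map_sub] at h1 h2
    rw [Multiset.map_add, Multiset.sum_add]
    simp [h] at h1 h2
    linarith
  rw [hs]
  exact ht

/-- The two middle points of an even multiset of points on the line can be merged into their
midpoint without changing the sum of distances outside the interval they span, and the sum of
distances is minimal on that interval. -/
theorem exists_foldedDist_eq (m : ℕ) (V : Multiset (EuclideanSpace ℝ (Fin 1)))
    (hV : V.card = 2 * m + 2) :
    ∃ (y z : ℝ) (u : Option (Fin (2 * m)) → ℝ), 2 * u none = y + z ∧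
      (∀ x : EuclideanSpace ℝ (Fin 1), x 0 ≤ y ∨ z ≤ x 0 → sumDist V x = foldedDist u (x 0)) ∧
      ∀ p x : EuclideanSpace ℝ (Fin 1), y ≤ p 0 → p 0 ≤ z → sumDist V p ≤ sumDist V x := by
  obtain ⟨y, z, L, U, hM, hL, hU, hyz, hLy, hzU⟩ :=
    Multiset.exists_middle_pair (V.map fun v => v 0) m (by simpa using hV)
  obtain ⟨r, hr⟩ := Multiset.exists_map_univ_eq (L + U) (2 * m) (by
    rw [Multiset.card_add, hL, hU]; ring)
  refine ⟨y, z, fun a => a.elim ((y + z) / 2) r, by simp; ring, fun x hx => ?_,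
    fun p x hyp hpz => ?_⟩
  · rw [sumDist_fin_one, hM, ← hr, foldedDist, Fintype.sum_option]
    simp only [Option.elim, Multiset.map_cons, Multiset.sum_cons, Multiset.map_map,
      Function.comp_def, one_mul]
    rw [← add_assoc]
    refine congrArg₂ (· + ·) ?_ rfl
    rcases hx with hx | hx
    · rw [abs_of_nonpos (by linarith), abs_of_nonpos (by linarith), abs_of_nonpos (by linarith)]
      ring
    · rw [abs_of_nonneg (by linarith), abs_of_nonneg (by linarith), abs_of_nonneg (by linarith)]
      ring
  · have h := sum_map_abs_sub_le (y ::ₘ L) (z ::ₘ U) (by simp [hL, hU]) (s := p 0) (t := x 0)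
      (by
        simp only [Multiset.mem_cons, forall_eq_or_imp]
        exact ⟨hyp, fun a ha => (hLy a ha).trans hyp⟩)
      (by
        simp only [Multiset.mem_cons, forall_eq_or_imp]
        exact ⟨hpz, fun a ha => hpz.trans (hzU a ha)⟩)
    rw [Multiset.cons_add, Multiset.add_cons] at h
    rwa [sumDist_fin_one, sumDist_fin_one, hM]

/-- The index type of the affine functions whose signs determine the orderings of `C`. -/
abbrev FoldedIndex (q : ℕ) (C : Finset (EuclideanSpace ℝ (Fin 1))) : Type :=
  C × C × (Option (Fin q) ⊕ (Option (Fin q) → SignType) × (Option (Fin q) → SignType))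

/-- The linear parts of the affine functions indexed by `FoldedIndex`. -/
noncomputable def foldedLinear (q : ℕ) (C : Finset (EuclideanSpace ℝ (Fin 1))) :
    FoldedIndex q C → (Option (Fin q) → ℝ) →ₗ[ℝ] ℝ
  | (_, _, .inl a) => (2 : ℝ) • LinearMap.proj a
  | (_, _, .inr (ε, δ)) =>
    ∑ a, (a.elim 2 (fun _ => 1) * ((δ a : ℝ) - (ε a : ℝ))) • LinearMap.proj a

/-- The constant parts of the affine functions indexed by `FoldedIndex`. -/
noncomputable def foldedConst (q : ℕ) (C : Finset (EuclideanSpace ℝ (Fin 1))) :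
    FoldedIndex q C → ℝ
  | (x, y, .inl _) => -x.1 0 - y.1 0
  | (x, y, .inr (ε, δ)) => ∑ a, a.elim 2 (fun _ => 1) * ((ε a : ℝ) * x.1 0 - (δ a : ℝ) * y.1 0)

/-- The sign pattern of the affine functions indexed by `FoldedIndex`. -/
noncomputable def foldedPattern (q : ℕ) (C : Finset (EuclideanSpace ℝ (Fin 1)))
    (u : Option (Fin q) → ℝ) (i : FoldedIndex q C) : SignType :=
  sign (foldedLinear q C i u + foldedConst q C i)

lemma sign_sub_sub_eq_of_foldedPattern_eq {q : ℕ} {C : Finset (EuclideanSpace ℝ (Fin 1))}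
    {u u' : Option (Fin q) → ℝ} (h : foldedPattern q C u = foldedPattern q C u')
    {x y : EuclideanSpace ℝ (Fin 1)} (hx : x ∈ C) (hy : y ∈ C) (a : Option (Fin q)) :
    sign (2 * u a - x 0 - y 0) = sign (2 * u' a - x 0 - y 0) := by
  have := congrFun h (⟨x, hx⟩, ⟨y, hy⟩, .inl a)
  simp only [foldedPattern, foldedLinear, foldedConst, LinearMap.smul_apply, LinearMap.proj_apply,
    smul_eq_mul] at this
  convert this using 2 <;> ring

lemma foldedDist_lt_iff_of_foldedPattern_eq {q : ℕ} {C : Finset (EuclideanSpace ℝ (Fin 1))}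
    {u u' : Option (Fin q) → ℝ} (h : foldedPattern q C u = foldedPattern q C u')
    {x y : EuclideanSpace ℝ (Fin 1)} (hx : x ∈ C) (hy : y ∈ C) :
    foldedDist u (x 0) < foldedDist u (y 0) ↔ foldedDist u' (x 0) < foldedDist u' (y 0) := by
  have hsign : ∀ {t : EuclideanSpace ℝ (Fin 1)}, t ∈ C → ∀ a,
      sign (t 0 - u a) = sign (t 0 - u' a) := by
    intro t ht a
    have key : ∀ b : ℝ, sign (t 0 - b) = -sign (2 * b - t 0 - t 0) := by
      intro b
      rw [← Left.sign_neg, show -(2 * b - t 0 - t 0) = 2 * (t 0 - b) by ring, sign_mul,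
        sign_pos two_pos, one_mul]
    rw [key, key, sign_sub_sub_eq_of_foldedPattern_eq h ht ht]
  have hsub : ∀ v : Option (Fin q) → ℝ,
      foldedDist v (x 0) - foldedDist v (y 0) =
        foldedLinear q C (⟨x, hx⟩, ⟨y, hy⟩,
          .inr (fun a => sign (x 0 - v a), fun a => sign (y 0 - v a))) v +
        foldedConst q C (⟨x, hx⟩, ⟨y, hy⟩,
          .inr (fun a => sign (x 0 - v a), fun a => sign (y 0 - v a))) := by
    intro v
    simp only [foldedDist, foldedLinear, foldedConst, LinearMap.sum_apply, LinearMap.smul_apply,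
      LinearMap.proj_apply, smul_eq_mul]
    rw [← Finset.sum_sub_distrib, ← Finset.sum_add_distrib]
    refine Finset.sum_congr rfl fun a _ => ?_
    rw [← sign_mul_self (x 0 - v a), ← sign_mul_self (y 0 - v a)]
    ring
  have := congrFun h (⟨x, hx⟩, ⟨y, hy⟩, .inr (fun a => sign (x 0 - u a), fun a => sign (y 0 - u a)))
  rw [foldedPattern, foldedPattern, ← hsub] at this
  simp only [hsign hx, hsign hy] at this
  rw [← hsub] at this
  rw [← sub_neg, ← sign_eq_neg_one_iff, this, sign_eq_neg_one_iff, sub_neg]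

/-- `u` describes the comparisons of `sumDist V` on `C`, except possibly for a minimal point of
`C` which is the closest one to `u none`; the Boolean records whether there is such an exception. -/
def DescribedBy {q : ℕ} (C : Finset (EuclideanSpace ℝ (Fin 1)))
    (V : Multiset (EuclideanSpace ℝ (Fin 1))) (u : Option (Fin q) → ℝ) : Bool → Prop
  | false => ∀ c ∈ C, sumDist V c = foldedDist u (c 0)
  | true => ∃ p ∈ C, ∀ c ∈ C, c ≠ p → sumDist V c = foldedDist u (c 0) ∧
      sumDist V p < sumDist V c ∧
      (c 0 < p 0 → 0 < 2 * u none - c 0 - p 0) ∧ (p 0 < c 0 → 2 * u none - c 0 - p 0 < 0)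

theorem exists_describedBy (m : ℕ) (C : Finset (EuclideanSpace ℝ (Fin 1)))
    (V : Multiset (EuclideanSpace ℝ (Fin 1))) (hV : V.card = 2 * m + 2)
    (hinj : Set.InjOn (sumDist V) ↑C) :
    ∃ (u : Option (Fin (2 * m)) → ℝ) (b : Bool), DescribedBy C V u b := by
  obtain ⟨y, z, u, hu, hout, hmin⟩ := exists_foldedDist_eq m V hV
  refine ⟨u, ?_⟩
  by_cases hp : ∃ p ∈ C, y ≤ p 0 ∧ p 0 ≤ z
  · obtain ⟨p, hpC, hyp, hpz⟩ := hp
    refine ⟨true, p, hpC, fun c hc hcp => ?_⟩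
    have hlt : sumDist V p < sumDist V c :=
      lt_of_le_of_ne (hmin p c hyp hpz) fun h => hcp (hinj hc hpC h.symm)
    have hc' : c 0 < y ∨ z < c 0 := by
      by_contra! hcon
      exact absurd (hmin c p hcon.1 hcon.2) (not_le.mpr hlt)
    refine ⟨hout c (hc'.imp le_of_lt le_of_lt), hlt, fun h => ?_, fun h => ?_⟩
    · rcases hc' with hc' | hc' <;> linarith
    · rcases hc' with hc' | hc' <;> linarith
  · push Not at hp
    refine ⟨false, fun c hc => hout c ?_⟩
    rcases le_or_gt y (c 0) with h | h
    · exact Or.inr (hp c hc h).le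
    · exact Or.inl h.le

theorem sumDist_lt_iff_of_describedBy {q : ℕ} {C : Finset (EuclideanSpace ℝ (Fin 1))}
    {V V' : Multiset (EuclideanSpace ℝ (Fin 1))} {u u' : Option (Fin q) → ℝ} {b : Bool}
    (hV : DescribedBy C V u b) (hV' : DescribedBy C V' u' b)
    (h : foldedPattern q C u = foldedPattern q C u')
    {x y : EuclideanSpace ℝ (Fin 1)} (hx : x ∈ C) (hy : y ∈ C) :
    sumDist V x < sumDist V y ↔ sumDist V' x < sumDist V' y := by
  cases b with
  | false =>
    rw [hV x hx, hV y hy, hV' x hx, hV' y hy]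
    exact foldedDist_lt_iff_of_foldedPattern_eq h hx hy
  | true =>
    obtain ⟨p, hp, hpV⟩ := hV
    obtain ⟨p', hp', hpV'⟩ := hV'
    have hpp : p' = p := by
      by_contra hne
      have hs := sign_sub_sub_eq_of_foldedPattern_eq h hp hp' none
      rw [sub_right_comm] at hs
      obtain ⟨-, -, h1, h2⟩ := hpV p' hp' hne
      obtain ⟨-, -, h3, h4⟩ := hpV' p hp (Ne.symm hne)
      rcases lt_trichotomy (p 0) (p' 0) with hlt | heq | hlt
      · rw [sign_neg (h2 hlt), eq_comm, sign_eq_neg_one_iff] at hs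
        linarith [h3 hlt]
      · refine hne ?_
        ext i
        rw [Subsingleton.elim i 0, heq]
      · rw [sign_pos (h1 hlt), eq_comm, sign_eq_one_iff] at hs
        linarith [h4 hlt]
    subst hpp
    by_cases hyp : y = p'
    · subst hyp
      by_cases hxy : x = y
      · simp [hxy]
      · exact iff_of_false (hpV x hx hxy).2.1.not_gt (hpV' x hx hxy).2.1.not_gt
    · by_cases hxp : x = p'
      · subst hxp
        exact iff_of_true (hpV y hy hyp).2.1 (hpV' y hy hyp).2.1
      · rw [(hpV x hx hxp).1, (hpV y hy hyp).1, (hpV' x hx hxp).1, (hpV' y hy hyp).1]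
        exact foldedDist_lt_iff_of_foldedPattern_eq h hx hy

lemma range_eq_of_injective_of_card {α : Type*} (C : Finset α) (σ : Fin C.card → α)
    (hσ : Function.Injective σ) (hmem : ∀ i, σ i ∈ C) : Set.range σ = ↑C := by
  classical
  have : Finset.univ.image σ = C := by
    refine Finset.eq_of_subset_of_card_le (by simpa [Finset.subset_iff] using hmem) ?_
    rw [Finset.card_image_of_injective _ hσ, Finset.card_univ, Fintype.card_fin]
  simpa using congrArg (fun s : Finset α => (s : Set α)) this

lemma eq_of_strictMono_comp {α : Type*} {C : Finset α} {f g : α → ℝ} (hf : Set.InjOn f ↑C)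
    (hfg : ∀ x ∈ C, ∀ y ∈ C, f x < f y ↔ g x < g y) {σ τ : Fin C.card → α}
    (hσ : Function.Injective σ) (hσC : ∀ i, σ i ∈ C) (hτ : Function.Injective τ)
    (hτC : ∀ i, τ i ∈ C) (hfσ : StrictMono fun i => f (σ i)) (hgτ : StrictMono fun i => g (τ i)) :
    σ = τ := by
  have hfτ : StrictMono fun i => f (τ i) :=
    fun i j hij => (hfg _ (hτC i) _ (hτC j)).2 (hgτ hij)
  have hrange : Set.range (fun i => f (σ i)) = Set.range fun i => f (τ i) := by
    change Set.range (f ∘ σ) = Set.range (f ∘ τ)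
    rw [Set.range_comp, Set.range_comp, range_eq_of_injective_of_card C σ hσ hσC,
      range_eq_of_injective_of_card C τ hτ hτC]
  funext i
  exact hf (hσC i) (hτC i) (congrFun ((StrictMono.range_inj hfσ hfτ).1 hrange) i)

theorem psiCount_le_two_mul_ncard (m : ℕ) (C : Finset (EuclideanSpace ℝ (Fin 1))) :
    psiCount (2 * m + 2) C ≤ 2 * (Set.range (foldedPattern (2 * m) C)).ncard := by
  have hex : ∀ σ : PsiSet (2 * m + 2) C.card C,
      ∃ (V : Multiset (EuclideanSpace ℝ (Fin 1))) (u : Option (Fin (2 * m)) → ℝ) (b : Bool),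
        Set.InjOn (sumDist V) ↑C ∧ (StrictMono fun i => sumDist V (σ.1 i)) ∧
          DescribedBy C V u b := by
    rintro ⟨σ, -, -, V, hV, hinj, hmono⟩
    obtain ⟨u, b, h⟩ := exists_describedBy m C V hV hinj
    exact ⟨V, u, b, hinj, hmono, h⟩
  choose V u b hinj hmono hdesc using hex
  have key := Nat.card_le_card_of_injective
    (fun σ => ((b σ, ⟨_, u σ, rfl⟩) : Bool × Set.range (foldedPattern (2 * m) C))) (by
      intro σ τ h
      obtain ⟨hb, hu⟩ := Prod.mk.inj h
      have hτ := hdesc τ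
      rw [← hb] at hτ
      exact Subtype.ext <| eq_of_strictMono_comp (hinj σ)
        (fun x hx y hy => sumDist_lt_iff_of_describedBy (hdesc σ) hτ (Subtype.mk.inj hu) hx hy)
        σ.2.1 σ.2.2.1 τ.2.1 τ.2.2.1 (hmono σ) (hmono τ))
  rw [Nat.card_prod, Nat.card_eq_fintype_card (α := Bool), Fintype.card_bool] at key
  exact key

/-- For every even `k ≥ 2`, there is a constant `c` (depending only on `k`)
such that `ψ^max_{1,k}(n) ≤ c · n^{2k−2}` for all positive integers `n`. -/
theorem psiMax_one_even_upper (k : ℕ) (hk : 2 ≤ k) (hke : Even k) :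
    ∃ c : ℝ, 0 < c ∧ ∀ n : ℕ, 1 ≤ n →
      (psiMax 1 k n : ℝ) ≤ c * (n : ℝ) ^ (2 * k - 2) := by
  obtain ⟨m, rfl⟩ : ∃ m, k = 2 * m + 2 := by
    obtain ⟨j, rfl⟩ := hke
    exact ⟨j - 1, by omega⟩
  let K : ℕ := Fintype.card
    (Option (Fin (2 * m)) ⊕ (Option (Fin (2 * m)) → SignType) × (Option (Fin (2 * m)) → SignType))
  refine ⟨((2 * (2 * K + 1) ^ (2 * m + 1) : ℕ) : ℝ), by positivity, fun n hn => ?_⟩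
  have hbound : psiMax 1 (2 * m + 2) n ≤
      2 * (2 * K + 1) ^ (2 * m + 1) * n ^ (2 * (2 * m + 2) - 2) := by
    refine csSup_le' ?_
    rintro _ ⟨C, rfl, rfl⟩
    have h := ncard_range_sign_affine_le_card (foldedLinear (2 * m) C) (foldedConst (2 * m) C)
    rw [Module.finrank_fintype_fun_eq_card, Fintype.card_option, Fintype.card_fin,
      Fintype.card_prod, Fintype.card_prod, Fintype.card_coe] at h
    calc psiCount (2 * m + 2) C
        ≤ 2 * (Set.range (foldedPattern (2 * m) C)).ncard := psiCount_le_two_mul_ncard m C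
      _ ≤ 2 * (2 * (C.card * (C.card * K)) + 1) ^ (2 * m + 1) := Nat.mul_le_mul_left 2 h
      _ ≤ 2 * ((2 * K + 1) * C.card ^ 2) ^ (2 * m + 1) := by
        gcongr
        nlinarith [Nat.one_le_pow 2 _ hn]
      _ = _ := by
        rw [mul_pow, ← pow_mul, show 2 * (2 * m + 2) - 2 = 2 * (2 * m + 1) by omega, mul_assoc]
  exact_mod_cast hbound
end

section
/- For all integers d ≥ 2 and k ≥ 0, there exists a constant c > 0 (depending only on d) such that for every integer m ≥ 1 there exist sets Ĉ_1, Ĉ_2 ⊆ ℝ^d, each of size m, with ψ̂_k(Ĉ_1, Ĉ_2) ≥ c · m^{4d}. -/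
/-- The effective distance function `D̂_{k,Û}` on the disjoint union `ℝ^d ⊔ ℝ^d`
(left summand for points of `Ĉ_1`, right summand for points of `Ĉ_2`):
`D̂¹_{k,Û}(ĉ) = ‖ĉ − û_1‖ + ((k+1)ĉ + û_2)·e_1` on the left and
`D̂²_{k,Û}(ĉ) = ‖ĉ − û_2‖ + ((k+1)ĉ + û_1)·e_1` on the right, where `e_1` is the
first standard basis vector (so `v·e_1` is the first coordinate of `v`). -/
noncomputable def Dhat {d : ℕ} (hd : 0 < d) (k : ℕ)
    (U : EuclideanSpace ℝ (Fin d) × EuclideanSpace ℝ (Fin d)) :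
    EuclideanSpace ℝ (Fin d) ⊕ EuclideanSpace ℝ (Fin d) → ℝ
  | Sum.inl c => dist c U.1 + (((k : ℝ) + 1) * c ⟨0, hd⟩ + U.2 ⟨0, hd⟩)
  | Sum.inr c => dist c U.2 + (((k : ℝ) + 1) * c ⟨0, hd⟩ + U.1 ⟨0, hd⟩)

/-- `Ψ̂_k(Ĉ_1, Ĉ_2)`: the set of orderings of the disjoint union `Ĉ_1 ⊔ Ĉ_2`
(encoded as injective enumerations `σ : Fin n → ℝ^d ⊕ ℝ^d`, left components lying in
`Ĉ_1` and right components in `Ĉ_2`) along which `D̂_{k,Û}` is strictly increasing,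
for some pair `Û ∈ ℝ^d × ℝ^d`. -/
def PsiHatSet {d : ℕ} (hd : 0 < d) (k n : ℕ)
    (C₁ C₂ : Finset (EuclideanSpace ℝ (Fin d))) :
    Set (Fin n → (EuclideanSpace ℝ (Fin d) ⊕ EuclideanSpace ℝ (Fin d))) :=
  {σ | Function.Injective σ ∧
    (∀ i, Sum.elim (fun c => c ∈ C₁) (fun c => c ∈ C₂) (σ i)) ∧
    ∃ U : EuclideanSpace ℝ (Fin d) × EuclideanSpace ℝ (Fin d),
      StrictMono fun i => Dhat hd k U (σ i)}

/-- `ψ̂_k(Ĉ_1, Ĉ_2) = |Ψ̂_k(Ĉ_1, Ĉ_2)|`. -/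
noncomputable def psiHat {d : ℕ} (hd : 0 < d) (k : ℕ)
    (C₁ C₂ : Finset (EuclideanSpace ℝ (Fin d))) : ℕ :=
  Nat.card (PsiHatSet hd k (C₁.card + C₂.card) C₁ C₂)

open Finset Filter Topology

/-- The points `P` and `Q` have at least as many orderings as there are parameters `w` whose
effective distance functions are injective and pairwise order some two points oppositely. -/
theorem card_le_psiHat {d : ℕ} (hd : 0 < d) (k : ℕ) {ι W : Type*} [Fintype ι] [Finite W]
    (P Q : ι ↪ EuclideanSpace ℝ (Fin d))
    (U : W → EuclideanSpace ℝ (Fin d) × EuclideanSpace ℝ (Fin d))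
    (hinj : ∀ w, Function.Injective fun i => Dhat hd k (U w) (Sum.map P Q i))
    (hsep : ∀ w w', w ≠ w' → ∃ i j,
      Dhat hd k (U w) (Sum.map P Q i) < Dhat hd k (U w) (Sum.map P Q j) ∧
      Dhat hd k (U w') (Sum.map P Q j) < Dhat hd k (U w') (Sum.map P Q i)) :
    Nat.card W ≤ psiHat hd k (univ.map P) (univ.map Q) := by
  classical
  set n := (univ.map P).card + (univ.map Q).card with hn
  have hcard : Fintype.card (ι ⊕ ι) = n := by simp [hn]
  let φ : Fin n ≃ ι ⊕ ι := (Fintype.equivFinOfCardEq hcard).symm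
  let g : W → ι ⊕ ι → ℝ := fun w i => Dhat hd k (U w) (Sum.map P Q i)
  let τ : W → Fin n ≃ ι ⊕ ι := fun w => (Tuple.sort (g w ∘ φ)).trans φ
  have hτ : ∀ w, StrictMono (g w ∘ τ w) := fun w =>
    (Tuple.monotone_sort (g w ∘ φ)).strictMono_of_injective
      ((hinj w).comp (τ w).injective)
  have hpt : Function.Injective (Sum.map P Q) := Sum.map_injective.2 ⟨P.injective, Q.injective⟩
  have hmem : ∀ w, Sum.map P Q ∘ τ w ∈ PsiHatSet hd k n (univ.map P) (univ.map Q) := fun w => by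
    refine ⟨hpt.comp (τ w).injective, fun i => ?_, U w, hτ w⟩
    rcases h : τ w i with a | a <;> simp [h]
  have hfin : (PsiHatSet hd k n (univ.map P) (univ.map Q)).Finite := by
    refine (Set.Finite.pi' (t := fun _ : Fin n => ((((univ.map P).disjSum (univ.map Q)) :
      Finset _) : Set _)) fun _ => Finset.finite_toSet _).subset ?_
    rintro σ ⟨-, hσ, -⟩ i
    have := hσ i
    rcases h : σ i with a | a <;> simp_all
  have := hfin.to_subtype
  refine Nat.card_le_card_of_injective
    (fun w => (⟨_, hmem w⟩ : PsiHatSet hd k n (univ.map P) (univ.map Q))) fun w w' h => ?_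
  by_contra hne
  obtain ⟨i, j, h₁, h₂⟩ := hsep w w' hne
  have hττ : τ w = τ w' := Equiv.ext fun a => hpt (congrFun (Subtype.ext_iff.1 h) a)
  obtain ⟨a, rfl⟩ := (τ w).surjective i
  obtain ⟨b, rfl⟩ := (τ w).surjective j
  have hab : a < b := (hτ w).lt_iff_lt.1 h₁
  rw [hττ] at h₂
  exact absurd ((hτ w').lt_iff_lt.1 h₂) hab.asymm

theorem eventually_lt_of_hasDerivAt {F G : ℝ → ℝ} {f g : ℝ} (hF : HasDerivAt F f 0)
    (hG : HasDerivAt G g 0) (h : F 0 < G 0 ∨ F 0 = G 0 ∧ f < g) :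
    ∀ᶠ ε in 𝓝[>] 0, F ε < G ε := by
  rcases h with h | ⟨h, hfg⟩
  · exact (hF.continuousAt.eventually_lt hG.continuousAt h).filter_mono nhdsWithin_le_nhds
  · have hs := hasDerivAt_iff_tendsto_slope.1 (hG.sub hF)
    have := (hs.mono_left (nhdsGT_le_nhdsNE 0)).eventually_const_lt (sub_pos.2 hfg)
    filter_upwards [this, self_mem_nhdsWithin] with ε hε hpos
    have hpos : 0 < ε := hpos
    rw [slope_def_field] at hε
    simp only [Pi.sub_apply, h, sub_self, sub_zero] at hε
    exact sub_pos.1 ((div_pos_iff_of_pos_right hpos).1 hε)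

/-- To first order in `ε`, the effective distance from `ε • v` of the point in direction `e` at
effective distance `β + ε r` from the origin is `β + ε (r - ⟪e, v⟫)`. -/
theorem hasDerivAt_effective_distance {E : Type*} [NormedAddCommGroup E] [InnerProductSpace ℝ E]
    {e : E} (he : ‖e‖ = 1) (v : E) {K a β : ℝ} (ha : 0 < 1 + K * a) (hβ : 0 < β) (r : ℝ) :
    HasDerivAt (fun ε : ℝ => dist (((β + ε * r) / (1 + K * a)) • e) (ε • v) +
      K * ((β + ε * r) / (1 + K * a) * a)) (r - inner ℝ e v) 0 := by
  have hρ : HasDerivAt (fun ε : ℝ => (β + ε * r) / (1 + K * a)) (r / (1 + K * a)) 0 := by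
    simpa using (((hasDerivAt_id (0 : ℝ)).mul_const r).const_add β).div_const (1 + K * a)
  have hdist : (fun ε : ℝ => dist (((β + ε * r) / (1 + K * a)) • e) (ε • v)) =
      fun ε => √(((β + ε * r) / (1 + K * a)) ^ 2
        - 2 * (((β + ε * r) / (1 + K * a)) * (ε * inner ℝ e v)) + ε ^ 2 * ‖v‖ ^ 2) := by
    funext ε
    rw [dist_eq_norm, ← Real.sqrt_sq (norm_nonneg _), norm_sub_sq_real, norm_smul, norm_smul, he,
      real_inner_smul_left, real_inner_smul_right, mul_pow, mul_pow]
    simp only [Real.norm_eq_abs, sq_abs, mul_one, one_pow]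
  have hsq := ((hρ.pow 2).sub ((hρ.mul ((hasDerivAt_id (0 : ℝ)).mul_const (inner ℝ e v))).const_mul
    2)).add (((hasDerivAt_id (0 : ℝ)).pow 2).mul_const (‖v‖ ^ 2))
  have hpos : 0 < β / (1 + K * a) := div_pos hβ ha
  have hsqrt := hsq.sqrt (by simpa using ⟨hβ.ne', ha.ne'⟩)
  have := hsqrt.add ((hρ.mul_const a).const_mul K)
  have hfun := congrArg (fun F : ℝ → ℝ => fun ε => F ε + K * ((β + ε * r) / (1 + K * a) * a)) hdist
  beta_reduce at hfun
  rw [hfun]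
  refine this.congr_deriv ?_
  simp only [id, zero_mul, add_zero, mul_zero, sub_zero, Pi.add_apply, Pi.sub_apply, Pi.mul_apply,
    Pi.pow_apply, ne_eq, OfNat.ofNat_ne_zero, not_false_eq_true, zero_pow,
    Nat.reduceSub, pow_one, Nat.cast_ofNat]
  rw [Real.sqrt_sq hpos.le]
  have ha' := ha.ne'
  field_simp
  ring

/-- The limiting order of the construction: a ruler of `N` points `(d + 2) s`, and for each `j` a
comb of `n` points with gaps `(d + 2) n`, shifted according to `x j`. -/
def rulerValue {d n N : ℕ} (x : Fin d → Fin (n ^ 2 + 1)) : Fin N ⊕ Fin d × Fin n → ℤ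
  | Sum.inl s => (d + 2) * s
  | Sum.inr (j, t) => (d + 2) * (n * t - x j + n) - (j + 1)

theorem rulerValue_injective {d n N : ℕ} (x : Fin d → Fin (n ^ 2 + 1)) :
    Function.Injective (rulerValue (N := N) x) := by
  have hdvd : ∀ a b c : ℤ, (d + 2) * a = (d + 2) * b - c → |c| < d + 2 → c = 0 := fun a b c h hc =>
    Int.eq_zero_of_abs_lt_dvd ⟨b - a, by linarith⟩ hc
  have hd : (0 : ℤ) < d + 2 := by positivity
  rintro (s | ⟨j, t⟩) (s' | ⟨j', t'⟩) h <;> simp only [rulerValue] at h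
  · have := mul_left_cancel₀ hd.ne' h
    simpa [Fin.ext_iff] using this
  · have := hdvd _ _ _ h (by rw [abs_lt]; omega)
    omega
  · have := hdvd _ _ _ h.symm (by rw [abs_lt]; omega)
    omega
  · have hj := hdvd (n * t - x j + n) (n * t' - x j' + n) (j' - j) (by linarith)
      (by rw [abs_lt]; omega)
    obtain rfl : j = j' := Fin.ext (by omega)
    have := mul_left_cancel₀ hd.ne' (sub_left_injective h)
    have hn : (n : ℤ) ≠ 0 := by have := t.2; omega
    have ht : (n : ℤ) * t = n * t' := by linarith
    have := mul_left_cancel₀ hn ht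
    simpa [Fin.ext_iff] using this

theorem exists_rulerValue_lt {d n N : ℕ} (hN : n ≤ N) {x x' : Fin d → Fin (n ^ 2 + 1)}
    {j : Fin d} (h : x j < x' j) :
    ∃ a b : Fin N ⊕ Fin d × Fin n, rulerValue x a < rulerValue x b ∧
      rulerValue x' b < rulerValue x' a := by
  have hx' : (x' j : ℕ) ≤ n ^ 2 := Nat.lt_succ_iff.1 (x' j).2
  have h : (x j : ℕ) < x' j := h
  have hn : 0 < n := Nat.pos_of_ne_zero (by rintro rfl; simp at hx'; omega)
  set y := n ^ 2 - x' j with hy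
  have hyn : y / n < n := (Nat.div_lt_iff_lt_mul hn).2 (by rw [← sq]; omega)
  have hs : y % n < n := Nat.mod_lt _ hn
  refine ⟨Sum.inl ⟨y % n, hs.trans_le hN⟩,
    Sum.inr (j, ⟨n - 1 - y / n, (Nat.sub_le _ _).trans_lt (Nat.sub_one_lt hn.ne')⟩), ?_⟩
  have hxy : (n : ℤ) * ((n - 1 - y / n : ℕ) : ℤ) - x' j + n = ((y % n : ℕ) : ℤ) := by
    have h₁ : ((n - 1 - y / n : ℕ) : ℤ) = n - 1 - ((y / n : ℕ) : ℤ) := by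
      generalize y / n = q at hyn ⊢
      omega
    have h₂ : (n : ℤ) * ((y / n : ℕ) : ℤ) + ((y % n : ℕ) : ℤ) = (y : ℤ) := by
      exact_mod_cast Nat.div_add_mod y n
    have h₃ : (y : ℤ) = (n : ℤ) ^ 2 - x' j := by
      rw [hy, Nat.cast_sub hx']; push_cast; ring
    rw [h₁]; linarith
  have hj : (j : ℤ) < d := by exact_mod_cast j.2
  have hxx : (x j : ℤ) + 1 ≤ x' j := by exact_mod_cast h
  simp only [rulerValue]
  constructor
  · nlinarith
  · rw [hxy]; omega

theorem exists_rulerValue_lt_of_ne {d n N : ℕ} (hN : n ≤ N) {x x' : Fin d → Fin (n ^ 2 + 1)}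
    (h : x ≠ x') :
    ∃ a b : Fin N ⊕ Fin d × Fin n, rulerValue x a < rulerValue x b ∧
      rulerValue x' b < rulerValue x' a := by
  obtain ⟨j, hj⟩ := Function.ne_iff.1 h
  rcases hj.lt_or_gt with hj | hj
  · exact exists_rulerValue_lt hN hj
  · obtain ⟨a, b, h₁, h₂⟩ := exists_rulerValue_lt hN hj
    exact ⟨b, a, h₂, h₁⟩

/-- Directions realising `rulerValue` to first order: the opposite of the basis vector `p` for the
ruler and the `j`-th basis vector for the `j`-th comb. -/
noncomputable def rulerDirection {d : ℕ} (n N : ℕ) (p : Fin d) :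
    Fin N ⊕ Fin d × Fin n → EuclideanSpace ℝ (Fin d)
  | Sum.inl _ => -EuclideanSpace.single p 1
  | Sum.inr (j, _) => EuclideanSpace.single j 1

/-- First-order radial displacements realising `rulerValue`. -/
def rulerRadius (d n N : ℕ) : Fin N ⊕ Fin d × Fin n → ℝ
  | Sum.inl s => (d + 2) * s
  | Sum.inr (_, t) => (d + 2) * (n * t)

theorem norm_rulerDirection {d n N : ℕ} (p : Fin d) (i : Fin N ⊕ Fin d × Fin n) :
    ‖rulerDirection n N p i‖ = 1 := by
  rcases i with s | ⟨j, t⟩ <;> simp [rulerDirection]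

theorem rulerDirection_apply_nonneg {d n N : ℕ} {p q : Fin d} (h : q ≠ p)
    (i : Fin N ⊕ Fin d × Fin n) : 0 ≤ rulerDirection n N p i q := by
  rcases i with s | ⟨j, t⟩
  · simp [rulerDirection, h]
  · simp only [rulerDirection, PiLp.single_apply]
    split_ifs <;> norm_num

theorem exists_rulerRadius_sub_inner {d n : ℕ} (N : ℕ) (p : Fin d) (x : Fin d → Fin (n ^ 2 + 1)) :
    ∃ (v : EuclideanSpace ℝ (Fin d)) (b : ℝ), ∀ i : Fin N ⊕ Fin d × Fin n,
      rulerRadius d n N i - inner ℝ (rulerDirection n N p i) v = rulerValue x i + b := by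
  let w : Fin d → ℝ := fun j => (d + 2) * ((x j : ℕ) - n) + (j + 1)
  refine ⟨WithLp.toLp 2 fun j => w j - w p / 2, w p / 2, ?_⟩
  rintro (s | ⟨j, t⟩)
  · simp [rulerRadius, rulerDirection, rulerValue, EuclideanSpace.inner_single_left]
    ring
  · simp [rulerRadius, rulerDirection, rulerValue, EuclideanSpace.inner_single_left, w]
    ring

theorem pow_le_psiHat {d : ℕ} (hd : 2 ≤ d) (k n N : ℕ) (hN : n ≤ N) :
    ∃ C₁ C₂ : Finset (EuclideanSpace ℝ (Fin d)), C₁.card = N + d * n ∧ C₂.card = N + d * n ∧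
      ((n ^ 2 + 1) ^ d) ^ 2 ≤ psiHat (by omega : 0 < d) k C₁ C₂ := by
  have hd₀ : 0 < d := by omega
  let p : Fin d := ⟨1, hd⟩
  let o : Fin d := ⟨0, hd₀⟩
  have hop : o ≠ p := by simp [o, p]
  let ι := Fin N ⊕ Fin d × Fin n
  let X := Fin d → Fin (n ^ 2 + 1)
  let e : ι → EuclideanSpace ℝ (Fin d) := rulerDirection n N p
  have ha : ∀ i, 0 < 1 + ((k : ℝ) + 1) * e i o := fun i => by
    have := rulerDirection_apply_nonneg hop i
    positivity
  choose v b hv using exists_rulerRadius_sub_inner (n := n) N p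
  let pt : ℝ → ℝ → ι → EuclideanSpace ℝ (Fin d) := fun β ε i =>
    ((β + ε * rulerRadius d n N i) / (1 + ((k : ℝ) + 1) * e i o)) • e i
  let U : ℝ → X × X → EuclideanSpace ℝ (Fin d) × EuclideanSpace ℝ (Fin d) := fun ε w =>
    (ε • v w.1, ε • v w.2)
  let F : X × X → ι ⊕ ι → ℝ → ℝ := fun w i ε =>
    Dhat hd₀ k (U ε w) (Sum.map (pt 1 ε) (pt 2 ε) i)
  let L : X × X → ι ⊕ ι → ℤ ⊕ₗ ℤ := fun w i =>
    toLex (Sum.map (rulerValue w.1) (rulerValue w.2) i)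
  have hderiv : ∀ (w : X × X) (i : ι ⊕ ι), HasDerivAt (F w i)
      (Sum.elim (fun i => (rulerValue w.1 i : ℝ) + b w.1 + v w.2 o)
        (fun i => (rulerValue w.2 i : ℝ) + b w.2 + v w.1 o) i) 0 := by
    rintro w (i | i)
    · have h₁ := hasDerivAt_effective_distance (norm_rulerDirection p i) (v w.1) (ha i) one_pos
        (rulerRadius d n N i)
      rw [hv] at h₁
      refine ((h₁.add ((hasDerivAt_id (0 : ℝ)).mul_const (v w.2 o))).congr_of_eventuallyEq
        (.of_forall fun ε => ?_)).congr_deriv (by simp)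
      simp [F, Dhat, U, pt, e, o, add_assoc]
    · have h₁ := hasDerivAt_effective_distance (norm_rulerDirection p i) (v w.2) (ha i) two_pos
        (rulerRadius d n N i)
      rw [hv] at h₁
      refine ((h₁.add ((hasDerivAt_id (0 : ℝ)).mul_const (v w.1 o))).congr_of_eventuallyEq
        (.of_forall fun ε => ?_)).congr_deriv (by simp)
      simp [F, Dhat, U, pt, e, o, add_assoc]
  have hzero : ∀ (w : X × X) (i : ι ⊕ ι), F w i 0 = Sum.elim (fun _ => 1) (fun _ => 2) i := by
    have key : ∀ (β : ℝ) (i : ι), 0 < β → dist (pt β 0 i) 0 + ((k : ℝ) + 1) * pt β 0 i o = β := by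
      intro β i hβ
      have := ha i
      have hpos : 0 < β / (1 + ((k : ℝ) + 1) * e i o) := div_pos hβ this
      have hne : ‖e i‖ = 1 := norm_rulerDirection p i
      simp only [pt, zero_mul, add_zero, dist_zero_right, norm_smul, hne, Real.norm_eq_abs,
        abs_of_pos hpos, PiLp.smul_apply, smul_eq_mul]
      field_simp
    rintro w (i | i)
    · simpa [F, Dhat, U] using key 1 i one_pos
    · simpa [F, Dhat, U] using key 2 i two_pos
  have hlt : ∀ᶠ ε in 𝓝[>] (0 : ℝ), ∀ (w : X × X) (i j : ι ⊕ ι), L w i < L w j →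
      F w i ε < F w j ε := by
    simp only [eventually_all]
    intro w i j hij
    refine eventually_lt_of_hasDerivAt (hderiv w i) (hderiv w j) ?_
    rw [hzero, hzero]
    rcases i with i | i <;> rcases j with j | j <;> simp [L] at hij ⊢ <;> exact hij
  obtain ⟨ε, hε⟩ := hlt.exists
  have hL : ∀ w, Function.Injective (L w) := fun w => toLex.injective.comp
    (Sum.map_injective.2 ⟨rulerValue_injective _, rulerValue_injective _⟩)
  have hF : ∀ w, Function.Injective fun i => F w i ε := fun w i j hij => by
    by_contra hne
    rcases ((hL w).ne hne).lt_or_gt with h | h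
    · exact (hε w i j h).ne hij
    · exact (hε w j i h).ne' hij
  have hpt : Function.Injective (Sum.map (pt 1 ε) (pt 2 ε)) :=
    Function.Injective.of_comp (f := Dhat hd₀ k (U ε (0, 0))) (hF (0, 0))
  obtain ⟨h₁, h₂⟩ := Sum.map_injective.1 hpt
  refine ⟨univ.map ⟨pt 1 ε, h₁⟩, univ.map ⟨pt 2 ε, h₂⟩, by simp [ι], by simp [ι], ?_⟩
  have hcard : Nat.card (X × X) = ((n ^ 2 + 1) ^ d) ^ 2 := by simp [X, sq]
  rw [← hcard]
  refine card_le_psiHat hd₀ k _ _ (U ε) hF fun w w' hne => ?_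
  suffices h : ∃ i j, L w i < L w j ∧ L w' j < L w' i by
    obtain ⟨i, j, hi, hj⟩ := h
    exact ⟨i, j, hε w i j hi, hε w' j i hj⟩
  by_cases h : w.1 = w'.1
  · obtain ⟨i, j, hi, hj⟩ := exists_rulerValue_lt_of_ne hN
      (fun h' => hne (Prod.ext h h') : w.2 ≠ w'.2)
    exact ⟨Sum.inr i, Sum.inr j, by simpa [L] using hi, by simpa [L] using hj⟩
  · obtain ⟨i, j, hi, hj⟩ := exists_rulerValue_lt_of_ne hN h
    exact ⟨Sum.inl i, Sum.inl j, by simpa [L] using hi, by simpa [L] using hj⟩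

/-- For every `d ≥ 2` there is a constant `c > 0` (depending only on `d`) such that
for every `k ≥ 0` and `m ≥ 1` there exist sets `Ĉ_1, Ĉ_2 ⊆ ℝ^d`, each of size `m`,
with `ψ̂_k(Ĉ_1, Ĉ_2) ≥ c · m^{4d}`. -/
theorem exists_psiHat_ge (d : ℕ) (hd : 2 ≤ d) :
    ∃ c : ℝ, 0 < c ∧ ∀ k : ℕ, ∀ m : ℕ, 1 ≤ m →
      ∃ C₁ C₂ : Finset (EuclideanSpace ℝ (Fin d)), C₁.card = m ∧ C₂.card = m ∧
        c * (m : ℝ) ^ (4 * d) ≤ (psiHat (by omega : 0 < d) k C₁ C₂ : ℝ) := by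
  refine ⟨((2 * ((d : ℝ) + 1) ^ 2) ^ (2 * d))⁻¹, by positivity, fun k m _ => ?_⟩
  set n := m / (d + 1) with hn
  have hnm : n * (d + 1) ≤ m := Nat.div_mul_le_self m (d + 1)
  have hmn : m < (n + 1) * (d + 1) := by
    rw [mul_comm]; exact Nat.lt_mul_div_succ m (Nat.succ_pos d)
  have hdn : n + d * n ≤ m := by linarith
  obtain ⟨C₁, C₂, h₁, h₂, h⟩ := pow_le_psiHat hd k n (m - d * n) (by omega)
  have hm_eq : m - d * n + d * n = m := Nat.sub_add_cancel (le_add_self.trans hdn)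
  refine ⟨C₁, C₂, h₁.trans hm_eq, h₂.trans hm_eq, ?_⟩
  have hm : (m : ℝ) ≤ (n + 1) * (d + 1) := by exact_mod_cast hmn.le
  have hsq : (m : ℝ) ^ 2 ≤ 2 * ((d : ℝ) + 1) ^ 2 * ((n : ℝ) ^ 2 + 1) :=
    calc (m : ℝ) ^ 2 ≤ ((n + 1) * (d + 1)) ^ 2 := by gcongr
      _ = ((d : ℝ) + 1) ^ 2 * ((n : ℝ) + 1) ^ 2 := by ring
      _ ≤ ((d : ℝ) + 1) ^ 2 * (2 * ((n : ℝ) ^ 2 + 1)) := by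
        gcongr
        nlinarith [sq_nonneg ((n : ℝ) - 1)]
      _ = _ := by ring
  rw [inv_mul_le_iff₀ (by positivity)]
  calc (m : ℝ) ^ (4 * d) = ((m : ℝ) ^ 2) ^ (2 * d) := by rw [← pow_mul]; ring_nf
    _ ≤ (2 * ((d : ℝ) + 1) ^ 2 * ((n : ℝ) ^ 2 + 1)) ^ (2 * d) := by gcongr
    _ = (2 * ((d : ℝ) + 1) ^ 2) ^ (2 * d) * ((((n : ℝ) ^ 2 + 1) ^ d) ^ 2) := by
      rw [mul_pow, ← pow_mul, mul_comm d 2]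
    _ ≤ _ := by
      gcongr
      exact_mod_cast h
end

section
/- For every integer d ≥ 2 and every finite set C ⊆ ℝ^{d−1}, we have ψ̌(C, C) ≥ C(|C|, 2)² · C(ψ_1(C), 2), where C(a, 2) = a(a−1)/2 denotes the binomial coefficient. -/
/-- The function `Ď_{V̌}` for `V̌ = (v̌_1, v̌_2, x̌, y̌)`, on the disjoint union
`ℝ^{d−1} ⊔ ℝ^{d−1}` (left summand for points of `Č_1`, right for `Č_2`):
`Ď¹_{V̌}(č) = √(x̌² + ‖č − v̌_1‖²) − x̌` on the left, and `Ď²_{V̌}(č) = y̌ ‖č − v̌_2‖²`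
on the right. -/
noncomputable def Dcheck {e : ℕ} (v₁ v₂ : EuclideanSpace ℝ (Fin e)) (x y : ℝ) :
    EuclideanSpace ℝ (Fin e) ⊕ EuclideanSpace ℝ (Fin e) → ℝ
  | Sum.inl c => Real.sqrt (x ^ 2 + dist c v₁ ^ 2) - x
  | Sum.inr c => y * dist c v₂ ^ 2

/-- `Ψ̌(Č_1, Č_2)`: the set of orderings of `Č_1 ⊔ Č_2` (injective enumerations
`σ : Fin n → ℝ^{d−1} ⊕ ℝ^{d−1}`, left components in `Č_1`, right in `Č_2`) along which
`Ď_{V̌}` is strictly increasing, for some `V̌ = (v̌_1, v̌_2, x̌, y̌)` with `y̌ > 0`. -/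
def PsiCheckSet {e : ℕ} (n : ℕ) (C₁ C₂ : Finset (EuclideanSpace ℝ (Fin e))) :
    Set (Fin n → (EuclideanSpace ℝ (Fin e) ⊕ EuclideanSpace ℝ (Fin e))) :=
  {σ | Function.Injective σ ∧
    (∀ i, Sum.elim (fun c => c ∈ C₁) (fun c => c ∈ C₂) (σ i)) ∧
    ∃ (v₁ v₂ : EuclideanSpace ℝ (Fin e)) (x y : ℝ), 0 < y ∧
      StrictMono fun i => Dcheck v₁ v₂ x y (σ i)}

/-- `ψ̌(Č_1, Č_2) = |Ψ̌(Č_1, Č_2)|`. -/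
noncomputable def psiCheck {e : ℕ} (C₁ C₂ : Finset (EuclideanSpace ℝ (Fin e))) : ℕ :=
  Nat.card (PsiCheckSet (C₁.card + C₂.card) C₁ C₂)

open Filter Topology

/-- The pairs of indices `i < i'` in `Fin n`. -/
abbrev LtPair (n : ℕ) : Type := {z : Fin n × Fin n // z.1 < z.2}

theorem natCard_ltPair (n : ℕ) : Nat.card (LtPair n) = n.choose 2 := by
  let f : LtPair n ≃ (Σ j : Fin n, Fin j) :=
    { toFun := fun z => ⟨z.1.2, ⟨z.1.1, z.2⟩⟩
      invFun := fun w => ⟨(⟨w.2, w.2.2.trans w.1.2⟩, w.1), w.2.2⟩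
      left_inv := fun _ => rfl
      right_inv := fun _ => rfl }
  rw [Nat.card_congr f, Nat.card_sigma]
  simp only [Nat.card_eq_fintype_card, Fintype.card_fin]
  rw [Fin.sum_univ_eq_sum_range (fun i => i), Finset.sum_range_id, Nat.choose_two_right]

/-- The determinant with rows `(tᵢ, sᵢ, sᵢ²)`. -/
def rowDet (t₁ t₂ t₃ s₁ s₂ s₃ : ℝ) : ℝ :=
  (s₂ * s₃ ^ 2 - s₃ * s₂ ^ 2) * t₁ + (s₃ * s₁ ^ 2 - s₁ * s₃ ^ 2) * t₂ +
    (s₁ * s₂ ^ 2 - s₂ * s₁ ^ 2) * t₃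

theorem rowDet_quadratic (a b s₁ s₂ s₃ : ℝ) :
    rowDet (a * s₁ ^ 2 + b * s₁) (a * s₂ ^ 2 + b * s₂) (a * s₃ ^ 2 + b * s₃) s₁ s₂ s₃ = 0 := by
  unfold rowDet; ring

/-- No parabola `a s² + b s` takes values among the `t i` at three distinct `s j`. -/
def NoTriplePoint {n : ℕ} (t s : Fin n → ℝ) : Prop :=
  ∀ i₁ i₂ i₃ j₁ j₂ j₃ : Fin n, j₁ ≠ j₂ → j₁ ≠ j₃ → j₂ ≠ j₃ →
    rowDet (t i₁) (t i₂) (t i₃) (s j₁) (s j₂) (s j₃) ≠ 0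

section Arrangement

variable {n : ℕ} {t s : Fin n → ℝ}

/-- The pairs of index pairs whose two lines `a * s j ^ 2 + b * s j = t i` in the `(a, b)`-plane
cross at a point with `0 < a`. -/
def crossingSet (t s : Fin n → ℝ) : Set (LtPair n × LtPair n) :=
  {z | t z.1.1.1 * s z.2.1.2 < t z.1.1.2 * s z.2.1.1}

/-- `(a, b)` lies in the cell of the line arrangement whose leftmost vertex is the crossing point
`(a₀, b₀)` of the lines indexed by `z`. -/
structure IsRightOfCrossing (t s : Fin n → ℝ) (z : LtPair n × LtPair n) (a b a₀ b₀ : ℝ) :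
    Prop where
  pos : 0 < a
  ne : ∀ k l, t k ≠ a * s l ^ 2 + b * s l
  left_eq : t z.1.1.1 = a₀ * s z.2.1.1 ^ 2 + b₀ * s z.2.1.1
  right_eq : t z.1.1.2 = a₀ * s z.2.1.2 ^ 2 + b₀ * s z.2.1.2
  left_lt : a * s z.2.1.1 ^ 2 + b * s z.2.1.1 < t z.1.1.1
  lt_right : t z.1.1.2 < a * s z.2.1.2 ^ 2 + b * s z.2.1.2
  le_of_lt : ∀ k l, t k < a * s l ^ 2 + b * s l → t k ≤ a₀ * s l ^ 2 + b₀ * s l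
  ge_of_lt : ∀ k l, a * s l ^ 2 + b * s l < t k → a₀ * s l ^ 2 + b₀ * s l ≤ t k

theorem eq_or_eq_of_crossing (ht : Function.Injective t)
    (hgen : NoTriplePoint t s) {i i' k j j' l : Fin n} {a b : ℝ} (hj : j ≠ j')
    (h₁ : t i = a * s j ^ 2 + b * s j) (h₂ : t i' = a * s j' ^ 2 + b * s j')
    (h₃ : t k = a * s l ^ 2 + b * s l) : (k = i ∧ l = j) ∨ (k = i' ∧ l = j') := by
  by_cases h : l = j
  · subst h
    exact Or.inl ⟨ht (h₃.trans h₁.symm), rfl⟩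
  by_cases h' : l = j'
  · subst h'
    exact Or.inr ⟨ht (h₃.trans h₂.symm), rfl⟩
  refine absurd ?_ (hgen i i' k j j' l hj (Ne.symm h) (Ne.symm h'))
  rw [h₁, h₂, h₃, rowDet_quadratic]

theorem exists_isRightOfCrossing (ht : Function.Injective t) (hs : StrictMono s)
    (hs0 : ∀ j, 0 < s j) (hgen : NoTriplePoint t s) {z : LtPair n × LtPair n}
    (hz : z ∈ crossingSet t s) : ∃ a b a₀ b₀, IsRightOfCrossing t s z a b a₀ b₀ := by
  obtain ⟨⟨⟨i, i'⟩, hi⟩, ⟨⟨j, j'⟩, hj⟩⟩ := z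
  simp only [crossingSet, Set.mem_ofPred_eq] at hz hi hj
  have hsj : s j < s j' := hs hj
  have h0 := hs0 j
  have h0' := hs0 j'
  have hd : 0 < s j' - s j := sub_pos.2 hsj
  obtain ⟨a₀, ha₀⟩ : ∃ a₀, a₀ = (t i' / s j' - t i / s j) / (s j' - s j) := ⟨_, rfl⟩
  obtain ⟨b₀, hb₀⟩ : ∃ b₀, b₀ = t i / s j - a₀ * s j := ⟨_, rfl⟩
  have ha0 : 0 < a₀ := by
    rw [ha₀]
    refine div_pos (sub_pos.2 ?_) hd
    rw [div_lt_div_iff₀ h0 h0']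
    exact hz
  have h₁ : t i = a₀ * s j ^ 2 + b₀ * s j := by
    rw [hb₀]; field_simp; ring
  have h₂ : t i' = a₀ * s j' ^ 2 + b₀ * s j' := by
    have : a₀ * (s j' - s j) = t i' / s j' - t i / s j := by
      rw [ha₀]; field_simp
    have h3 : t i' / s j' = a₀ * s j' + b₀ := by rw [hb₀]; linarith
    rw [div_eq_iff h0'.ne'] at h3
    rw [h3]; ring
  let q : ℝ → Fin n → ℝ := fun δ l =>
    (a₀ + δ) * s l ^ 2 + (b₀ - δ * ((s j + s j') / 2)) * s l
  have hq : ∀ l, Continuous fun δ => q δ l := fun l => by fun_prop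
  have hq0 : ∀ l, q 0 l = a₀ * s l ^ 2 + b₀ * s l := fun l => by simp [q]
  have hlt : ∀ k l, ∀ᶠ δ in 𝓝[>] (0 : ℝ), t k < q 0 l → t k < q δ l := fun k l => by
    rw [eventually_imp_distrib_left]
    intro h
    exact ((hq l).continuousAt.eventually_const_lt h).filter_mono nhdsWithin_le_nhds
  have hgt : ∀ k l, ∀ᶠ δ in 𝓝[>] (0 : ℝ), q 0 l < t k → q δ l < t k := fun k l => by
    rw [eventually_imp_distrib_left]
    intro h
    exact ((hq l).continuousAt.eventually_lt_const h).filter_mono nhdsWithin_le_nhds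
  have hall := (eventually_all.2 fun k => eventually_all.2 fun l => (hlt k l).and (hgt k l)).and
    (self_mem_nhdsWithin (a := (0 : ℝ)) (s := Set.Ioi 0))
  obtain ⟨δ, hδ, hδ0⟩ := hall.exists
  replace hδ0 : 0 < δ := hδ0
  have hl : q δ j < t i := by
    have : q δ j = t i - δ * s j * ((s j' - s j) / 2) := by rw [h₁]; simp only [q]; ring
    rw [this]
    have : 0 < δ * s j * ((s j' - s j) / 2) := by positivity
    linarith
  have hr : t i' < q δ j' := by
    have : q δ j' = t i' + δ * s j' * ((s j' - s j) / 2) := by rw [h₂]; simp only [q]; ring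
    rw [this]
    have : 0 < δ * s j' * ((s j' - s j) / 2) := by positivity
    linarith
  refine ⟨a₀ + δ, b₀ - δ * ((s j + s j') / 2), a₀, b₀, by linarith, ?_, h₁, h₂, hl, hr, ?_, ?_⟩
  · intro k l
    change t k ≠ q δ l
    rcases lt_trichotomy (t k) (q 0 l) with h | h | h
    · exact ((hδ k l).1 h).ne
    · rw [hq0] at h
      rcases eq_or_eq_of_crossing ht hgen hj.ne h₁ h₂ h with ⟨rfl, rfl⟩ | ⟨rfl, rfl⟩
      · exact hl.ne'
      · exact hr.ne
    · exact ((hδ k l).2 h).ne'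
  · intro k l h
    rw [← hq0]
    by_contra! h'
    exact lt_asymm h ((hδ k l).2 h')
  · intro k l h
    rw [← hq0]
    by_contra! h'
    exact lt_asymm h ((hδ k l).1 h')

theorem IsRightOfCrossing.vertex_le {z z' : LtPair n × LtPair n} {a b a₀ b₀ c d c₀ d₀ : ℝ}
    (hs : StrictMono s) (hs0 : ∀ j, 0 < s j)
    (h : IsRightOfCrossing t s z a b a₀ b₀) (h' : IsRightOfCrossing t s z' c d c₀ d₀)
    (hiff : ∀ k l, t k < a * s l ^ 2 + b * s l ↔ t k < c * s l ^ 2 + d * s l) :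
    a₀ ≤ c₀ ∧ (a₀ = c₀ → b₀ = d₀) := by
  have hsj : s z.2.1.1 < s z.2.1.2 := hs z.2.2
  have h0 := hs0 z.2.1.1
  have h0' := hs0 z.2.1.2
  have h₁ : c * s z.2.1.1 ^ 2 + d * s z.2.1.1 < t z.1.1.1 := by
    refine lt_of_le_of_ne (not_lt.1 fun hc => ?_) (h'.ne _ _).symm
    exact lt_asymm ((hiff _ _).2 hc) h.left_lt
  have h₁' := h'.ge_of_lt _ _ h₁
  have h₂' := h'.le_of_lt _ _ ((hiff _ _).1 h.lt_right)
  rw [h.left_eq] at h₁'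
  rw [h.right_eq] at h₂'
  have e₁ : c₀ * s z.2.1.1 + d₀ ≤ a₀ * s z.2.1.1 + b₀ :=
    le_of_mul_le_mul_right (by linarith) h0
  have e₂ : a₀ * s z.2.1.2 + b₀ ≤ c₀ * s z.2.1.2 + d₀ :=
    le_of_mul_le_mul_right (by linarith) h0'
  constructor
  · by_contra! hlt
    nlinarith
  · rintro rfl
    linarith

theorem IsRightOfCrossing.eq_of_iff {z z' : LtPair n × LtPair n} {a b a₀ b₀ c d c₀ d₀ : ℝ}
    (ht : Function.Injective t) (hs : StrictMono s) (hs0 : ∀ j, 0 < s j)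
    (hgen : NoTriplePoint t s)
    (h : IsRightOfCrossing t s z a b a₀ b₀) (h' : IsRightOfCrossing t s z' c d c₀ d₀)
    (hiff : ∀ k l, t k < a * s l ^ 2 + b * s l ↔ t k < c * s l ^ 2 + d * s l) :
    z = z' := by
  obtain ⟨hle, hb⟩ := h.vertex_le hs hs0 h' hiff
  obtain ⟨hle', -⟩ := h'.vertex_le hs hs0 h fun k l => (hiff k l).symm
  obtain rfl := le_antisymm hle hle'
  obtain rfl := hb rfl
  obtain ⟨⟨⟨i, i'⟩, hi⟩, ⟨⟨j, j'⟩, hj⟩⟩ := z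
  obtain ⟨⟨⟨k, k'⟩, hk⟩, ⟨⟨l, l'⟩, hl⟩⟩ := z'
  have e := eq_or_eq_of_crossing ht hgen (ne_of_lt hj) h.left_eq h.right_eq h'.left_eq
  have e' := eq_or_eq_of_crossing ht hgen (ne_of_lt hj) h.left_eq h.right_eq h'.right_eq
  simp only at e e' hi hj hk hl
  rcases e with ⟨rfl, rfl⟩ | ⟨rfl, rfl⟩ <;> rcases e' with ⟨rfl, rfl⟩ | ⟨rfl, rfl⟩
  · exact absurd hl (lt_irrefl _)
  · rfl
  · exact absurd hl hj.not_gt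
  · exact absurd hl (lt_irrefl _)

end Arrangement

section Perturbation

variable {e : ℕ}

theorem eventually_quadratic_ne_zero {A : ℝ} (hA : A ≠ 0) (B G : ℝ) :
    ∀ᶠ τ in 𝓝[≠] (0 : ℝ), A * τ ^ 2 + B * τ + G ≠ 0 := by
  let P : Polynomial ℝ := .C A * .X ^ 2 + .C B * .X + .C G
  have hP : P ≠ 0 := fun h => by
    have := congrArg (fun Q => Polynomial.coeff Q 2) h
    simp [P] at this
    exact hA this
  have hev : ∀ᶠ τ in 𝓝[≠] (0 : ℝ), ¬P.IsRoot τ :=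
    nhdsNE_le_cofinite 0 (Polynomial.finite_setOfPred_isRoot hP).compl_mem_cofinite
  filter_upwards [hev] with τ hτ h0
  exact hτ (by simpa [P, Polynomial.IsRoot] using h0)

theorem eventually_sum_dist_sq_ne_zero {u : EuclideanSpace ℝ (Fin e)} (hu : ‖u‖ = 1)
    (v c₁ c₂ c₃ : EuclideanSpace ℝ (Fin e)) {α₁ α₂ α₃ : ℝ} (hα : α₁ + α₂ + α₃ ≠ 0) :
    ∀ᶠ τ in 𝓝[≠] (0 : ℝ), α₁ * dist c₁ (v + τ • u) ^ 2 + α₂ * dist c₂ (v + τ • u) ^ 2 +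
      α₃ * dist c₃ (v + τ • u) ^ 2 ≠ 0 := by
  have key : ∀ (c : EuclideanSpace ℝ (Fin e)) (τ : ℝ), dist c (v + τ • u) ^ 2 =
      ‖c - v‖ ^ 2 - 2 * τ * inner ℝ (c - v) u + τ ^ 2 := fun c τ => by
    rw [dist_eq_norm, ← sub_sub, norm_sub_sq_real, inner_smul_right, norm_smul, hu, mul_one,
      Real.norm_eq_abs, sq_abs]
    ring
  filter_upwards [eventually_quadratic_ne_zero hα
    (-2 * (α₁ * inner ℝ (c₁ - v) u + α₂ * inner ℝ (c₂ - v) u + α₃ * inner ℝ (c₃ - v) u))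
    (α₁ * ‖c₁ - v‖ ^ 2 + α₂ * ‖c₂ - v‖ ^ 2 + α₃ * ‖c₃ - v‖ ^ 2)] with τ hτ h0
  apply hτ
  rw [← h0]
  simp only [key]
  ring

variable {n : ℕ} (p q : Fin n → EuclideanSpace ℝ (Fin e))

/-- The squared distances from a point to the points of an enumeration. -/
noncomputable def sqDist (v : EuclideanSpace ℝ (Fin e)) (i : Fin n) : ℝ := dist (p i) v ^ 2

variable {p q}

theorem eventually_noTriplePoint {u : EuclideanSpace ℝ (Fin e)} (hu : ‖u‖ = 1)
    (v : EuclideanSpace ℝ (Fin e)) {s : Fin n → ℝ} (hs : Function.Injective s) :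
    ∀ᶠ τ in 𝓝[≠] (0 : ℝ), NoTriplePoint (sqDist p (v + τ • u)) s := by
  simp only [NoTriplePoint, eventually_all]
  intro i₁ i₂ i₃ j₁ j₂ j₃ h₁₂ h₁₃ h₂₃
  refine eventually_sum_dist_sq_ne_zero hu v _ _ _ ?_
  have : s j₂ * s j₃ ^ 2 - s j₃ * s j₂ ^ 2 + (s j₃ * s j₁ ^ 2 - s j₁ * s j₃ ^ 2) +
      (s j₁ * s j₂ ^ 2 - s j₂ * s j₁ ^ 2) = (s j₂ - s j₁) * (s j₃ - s j₁) * (s j₃ - s j₂) := by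
    ring
  rw [this]
  exact mul_ne_zero (mul_ne_zero (sub_ne_zero.2 (hs.ne h₁₂.symm)) (sub_ne_zero.2 (hs.ne h₁₃.symm)))
    (sub_ne_zero.2 (hs.ne h₂₃.symm))

theorem eventually_sqDist_pos {u : EuclideanSpace ℝ (Fin e)} (hu : ‖u‖ = 1)
    (v : EuclideanSpace ℝ (Fin e)) :
    ∀ᶠ τ in 𝓝[≠] (0 : ℝ), ∀ i, 0 < sqDist p (v + τ • u) i := by
  rw [eventually_all]
  intro i
  filter_upwards [eventually_sum_dist_sq_ne_zero hu v (p i) (p i) (p i)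
    (α₁ := 1) (α₂ := 0) (α₃ := 0) (by norm_num)] with τ hτ
  exact lt_of_le_of_ne (sq_nonneg _) (Ne.symm (by simpa [sqDist] using hτ))

theorem continuous_sqDist_line (u v : EuclideanSpace ℝ (Fin e)) (i : Fin n) :
    Continuous fun τ : ℝ => sqDist p (v + τ • u) i := by
  unfold sqDist; fun_prop

theorem eventually_strictMono_sqDist (u : EuclideanSpace ℝ (Fin e))
    {v : EuclideanSpace ℝ (Fin e)} (hv : StrictMono (sqDist p v)) :
    ∀ᶠ τ in 𝓝[≠] (0 : ℝ), StrictMono (sqDist p (v + τ • u)) := by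
  simp only [StrictMono, eventually_all]
  intro i j hij
  refine Eventually.filter_mono nhdsWithin_le_nhds ?_
  refine (continuous_sqDist_line u v i).continuousAt.eventually_lt
    (continuous_sqDist_line u v j).continuousAt ?_
  simpa using hv hij

/-- Two vantage points in general position for the enumerations `p` and `q`. -/
structure IsGenericPair (p q : Fin n → EuclideanSpace ℝ (Fin e))
    (v w : EuclideanSpace ℝ (Fin e)) : Prop where
  left_strictMono : StrictMono (sqDist p v)
  right_strictMono : StrictMono (sqDist q w)
  left_pos : ∀ i, 0 < sqDist p v i
  right_pos : ∀ i, 0 < sqDist q w i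
  noTriple : NoTriplePoint (sqDist p v) (sqDist q w)
  noTriple_symm : NoTriplePoint (sqDist q w) (sqDist p v)
  ratio_ne : ∀ i i' j j', j < j' →
    sqDist p v i * sqDist q w j' - sqDist p v i' * sqDist q w j ≠ 0

theorem exists_isGenericPair (he : 1 ≤ e) {v₀ w₀ : EuclideanSpace ℝ (Fin e)}
    (hv : StrictMono (sqDist p v₀)) (hw : StrictMono (sqDist q w₀)) :
    ∃ v w, IsGenericPair p q v w := by
  obtain ⟨u, hu⟩ : ∃ u : EuclideanSpace ℝ (Fin e), ‖u‖ = 1 :=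
    ⟨EuclideanSpace.single ⟨0, he⟩ 1, by simp⟩
  have hratio : ∀ᶠ τ in 𝓝[≠] (0 : ℝ), ∀ i i' j j', j < j' →
      sqDist p (v₀ + τ • u) i * sqDist q w₀ j' - sqDist p (v₀ + τ • u) i' * sqDist q w₀ j ≠ 0 := by
    simp only [eventually_all]
    intro i i' j j' hj
    filter_upwards [eventually_sum_dist_sq_ne_zero hu v₀ (p i) (p i') (p i)
      (α₁ := sqDist q w₀ j') (α₂ := -sqDist q w₀ j) (α₃ := 0)
      (by have := hw hj; linarith)] with τ hτ h0
    apply hτ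
    simp only [sqDist] at h0 ⊢
    linear_combination h0
  obtain ⟨τ, hm, hpos, hgen, hr⟩ := ((eventually_strictMono_sqDist u hv).and
    ((eventually_sqDist_pos (p := p) hu v₀).and
      ((eventually_noTriplePoint (p := p) hu v₀ hw.injective).and hratio))).exists
  generalize v₀ + τ • u = v at hm hpos hgen hr
  have hcont := fun i => continuous_sqDist_line (p := q) u w₀ i
  have hgen' : ∀ᶠ τ in 𝓝[≠] (0 : ℝ), NoTriplePoint (sqDist p v) (sqDist q (w₀ + τ • u)) := by
    simp only [NoTriplePoint, eventually_all]
    intro i₁ i₂ i₃ j₁ j₂ j₃ h₁₂ h₁₃ h₂₃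
    refine Eventually.filter_mono nhdsWithin_le_nhds ?_
    refine ContinuousAt.eventually_ne (Continuous.continuousAt ?_) ?_
    · unfold rowDet; fun_prop
    · simpa using hgen i₁ i₂ i₃ j₁ j₂ j₃ h₁₂ h₁₃ h₂₃
  have hr' : ∀ᶠ τ in 𝓝[≠] (0 : ℝ), ∀ i i' j j', j < j' →
      sqDist p v i * sqDist q (w₀ + τ • u) j' - sqDist p v i' * sqDist q (w₀ + τ • u) j ≠ 0 := by
    simp only [eventually_all]
    intro i i' j j' hj
    refine Eventually.filter_mono nhdsWithin_le_nhds ?_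
    refine ContinuousAt.eventually_ne (Continuous.continuousAt ?_) ?_
    · fun_prop
    · simpa using hr i i' j j' hj
  obtain ⟨τ', hm', hpos', hgenw, hgenv, hr⟩ := ((eventually_strictMono_sqDist u hw).and
    ((eventually_sqDist_pos (p := q) hu w₀).and
      ((eventually_noTriplePoint (p := q) hu w₀ hm.injective).and (hgen'.and hr')))).exists
  exact ⟨v, w₀ + τ' • u, hm, hm', hpos, hpos', hgenv, hgenw, hr⟩

end Perturbation

theorem exists_strictMono_enum {β : Type*} (A : Finset β) {m : ℕ} (hm : A.card = m) {f : β → ℝ}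
    (hf : Set.InjOn f A) :
    ∃ σ : Fin m → β, Function.Injective σ ∧ (∀ i, σ i ∈ A) ∧ StrictMono fun i => f (σ i) := by
  classical
  have hc : (A.image f).card = m := by rw [Finset.card_image_of_injOn hf, hm]
  have hmem : ∀ i, ∃ b ∈ A, f b = (A.image f).orderEmbOfFin hc i := fun i =>
    Finset.mem_image.1 (Finset.orderEmbOfFin_mem _ hc i)
  choose σ hσ hfσ using hmem
  have hmono : StrictMono fun i => f (σ i) := by
    simp only [hfσ]
    exact ((A.image f).orderEmbOfFin hc).strictMono
  exact ⟨σ, fun i j h => hmono.injective (congrArg f h), hσ, hmono⟩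

theorem range_eq_of_injective {β : Type*} {A : Finset β} {m : ℕ} (hm : A.card = m)
    {σ : Fin m → β} (hσ : Function.Injective σ) (hmem : ∀ i, σ i ∈ A) : Set.range σ = A := by
  classical
  have h : Finset.univ.image σ = A := by
    refine Finset.eq_of_subset_of_card_le (fun b hb => ?_) ?_
    · obtain ⟨i, -, rfl⟩ := Finset.mem_image.1 hb
      exact hmem i
    · rw [Finset.card_image_of_injective _ hσ, hm, Finset.card_univ, Fintype.card_fin]
  rw [← h]
  simp

theorem eq_of_strictMono_comp_s11 {β : Type*} {A : Finset β} {m : ℕ} (hm : A.card = m)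
    {p p' : Fin m → β} (hp : ∀ i, p i ∈ A) (hp' : ∀ i, p' i ∈ A) {f : β → ℝ}
    (hf : StrictMono fun i => f (p i)) (hf' : StrictMono fun i => f (p' i)) : p = p' := by
  have hr := range_eq_of_injective hm (fun i j h => hf.injective (congrArg f h)) hp
  have hr' := range_eq_of_injective hm (fun i j h => hf'.injective (congrArg f h)) hp'
  have hinj : Set.InjOn f A := by
    rw [← hr]
    rintro _ ⟨i, rfl⟩ _ ⟨j, rfl⟩ h
    rw [hf.injective h]
  have hcomp : (fun i => f (p i)) = fun i => f (p' i) := by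
    refine (hf.range_inj hf').1 ?_
    rw [Set.range_comp' f p, Set.range_comp' f p', hr, hr']
  funext i
  exact hinj (hp i) (hp' i) (congrFun hcomp i)

section Dcheck

variable {e : ℕ} {v w : EuclideanSpace ℝ (Fin e)} {x y : ℝ}

theorem Dcheck_inl_lt_inl {c c' : EuclideanSpace ℝ (Fin e)} :
    Dcheck v w x y (.inl c) < Dcheck v w x y (.inl c') ↔ dist c v ^ 2 < dist c' v ^ 2 := by
  simp only [Dcheck, sub_lt_sub_iff_right]
  rw [Real.sqrt_lt_sqrt_iff (by positivity), add_lt_add_iff_left]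

theorem Dcheck_inr_lt_inr (hy : 0 < y) {c c' : EuclideanSpace ℝ (Fin e)} :
    Dcheck v w x y (.inr c) < Dcheck v w x y (.inr c') ↔ dist c w ^ 2 < dist c' w ^ 2 := by
  simp only [Dcheck]
  exact mul_lt_mul_iff_right₀ hy

theorem sqrt_sub_lt_iff {x r t : ℝ} (hr : 0 < r) (ht : 0 ≤ t) :
    √(x ^ 2 + t) - x < r ↔ t < r ^ 2 + 2 * x * r := by
  rw [sub_lt_iff_lt_add]
  constructor
  · intro h
    have h2 := (Real.sqrt_lt' (lt_of_le_of_lt (Real.sqrt_nonneg _) h)).1 h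
    linarith
  · intro h
    have h2 : 0 < r + 2 * x := by
      by_contra! hc
      nlinarith
    rw [Real.sqrt_lt' (by linarith)]
    linarith

theorem lt_sqrt_sub_iff {x r t : ℝ} (hr : 0 < r) (ht : 0 ≤ t) :
    r < √(x ^ 2 + t) - x ↔ r ^ 2 + 2 * x * r < t := by
  rw [lt_sub_iff_add_lt]
  constructor
  · intro h
    rcases le_or_gt 0 (r + x) with h0 | h0
    · have := (Real.lt_sqrt h0).1 h
      linarith
    · nlinarith
  · intro h
    exact Real.lt_sqrt_of_sq_lt (by linarith)

theorem Dcheck_inl_lt_inr {a b : ℝ} (ha : 0 < a) {c c' : EuclideanSpace ℝ (Fin e)}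
    (hc : 0 < dist c' w ^ 2) :
    Dcheck v w (b / (2 * √a)) √a (.inl c) < Dcheck v w (b / (2 * √a)) √a (.inr c') ↔
      dist c v ^ 2 < a * (dist c' w ^ 2) ^ 2 + b * dist c' w ^ 2 := by
  have hy : 0 < √a := Real.sqrt_pos.2 ha
  simp only [Dcheck]
  rw [sqrt_sub_lt_iff (mul_pos hy hc) (sq_nonneg _), mul_pow, Real.sq_sqrt ha.le]
  have : 2 * (b / (2 * √a)) * (√a * dist c' w ^ 2) = b * dist c' w ^ 2 := by field_simp
  rw [this]

theorem Dcheck_inr_lt_inl {a b : ℝ} (ha : 0 < a) {c c' : EuclideanSpace ℝ (Fin e)}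
    (hc : 0 < dist c' w ^ 2) :
    Dcheck v w (b / (2 * √a)) √a (.inr c') < Dcheck v w (b / (2 * √a)) √a (.inl c) ↔
      a * (dist c' w ^ 2) ^ 2 + b * dist c' w ^ 2 < dist c v ^ 2 := by
  have hy : 0 < √a := Real.sqrt_pos.2 ha
  simp only [Dcheck]
  rw [lt_sqrt_sub_iff (mul_pos hy hc) (sq_nonneg _), mul_pow, Real.sq_sqrt ha.le]
  have : 2 * (b / (2 * √a)) * (√a * dist c' w ^ 2) = b * dist c' w ^ 2 := by field_simp
  rw [this]

end Dcheck

section Fibers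

variable {e : ℕ} {C : Finset (EuclideanSpace ℝ (Fin e))}

/-- The orderings in `Ψ̌(C, C)` inducing the order `p` on the left and `q` on the right copy. -/
def orderFiber (C : Finset (EuclideanSpace ℝ (Fin e)))
    (p q : Fin C.card → EuclideanSpace ℝ (Fin e)) :
    Set (Fin (C.card + C.card) → (EuclideanSpace ℝ (Fin e) ⊕ EuclideanSpace ℝ (Fin e))) :=
  {σ | Function.Injective σ ∧ (∀ i, σ i ∈ C.disjSum C) ∧
    ∃ (v w : EuclideanSpace ℝ (Fin e)) (x y : ℝ), 0 < y ∧
      (StrictMono fun i => Dcheck v w x y (σ i)) ∧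
      (StrictMono fun i => Dcheck v w x y (.inl (p i))) ∧
      (StrictMono fun i => Dcheck v w x y (.inr (q i)))}

theorem orderFiber_subset (p q : Fin C.card → EuclideanSpace ℝ (Fin e)) :
    orderFiber C p q ⊆ PsiCheckSet (C.card + C.card) C C := by
  rintro σ ⟨hinj, hmem, v, w, x, y, hy, hmono, -, -⟩
  refine ⟨hinj, fun i => ?_, v, w, x, y, hy, hmono⟩
  have := hmem i
  cases h : σ i <;> simpa [h] using this

theorem Dcheck_lt_iff_of_strictMono {σ : Fin (C.card + C.card) →
      (EuclideanSpace ℝ (Fin e) ⊕ EuclideanSpace ℝ (Fin e))}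
    (hinj : Function.Injective σ) (hmem : ∀ i, σ i ∈ C.disjSum C)
    {f f' : EuclideanSpace ℝ (Fin e) ⊕ EuclideanSpace ℝ (Fin e) → ℝ}
    (hf : StrictMono fun i => f (σ i)) (hf' : StrictMono fun i => f' (σ i))
    {c c' : EuclideanSpace ℝ (Fin e) ⊕ EuclideanSpace ℝ (Fin e)}
    (hc : c ∈ C.disjSum C) (hc' : c' ∈ C.disjSum C) : f c < f c' ↔ f' c < f' c' := by
  have hr := range_eq_of_injective (Finset.card_disjSum C C) hinj hmem
  have h : ∀ c ∈ C.disjSum C, c ∈ Set.range σ := fun c hc => by rw [hr]; exact hc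
  obtain ⟨i, rfl⟩ := h c hc
  obtain ⟨j, rfl⟩ := h c' hc'
  exact hf.lt_iff_lt.trans hf'.lt_iff_lt.symm

theorem eq_of_mem_orderFiber {p q p' q' : Fin C.card → EuclideanSpace ℝ (Fin e)}
    (hp : ∀ i, p i ∈ C) (hq : ∀ i, q i ∈ C) (hp' : ∀ i, p' i ∈ C) (hq' : ∀ i, q' i ∈ C)
    {σ : Fin (C.card + C.card) → (EuclideanSpace ℝ (Fin e) ⊕ EuclideanSpace ℝ (Fin e))}
    (h : σ ∈ orderFiber C p q) (h' : σ ∈ orderFiber C p' q') : p = p' ∧ q = q' := by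
  obtain ⟨hinj, hmem, v, w, x, y, -, hmono, hl, hr⟩ := h
  obtain ⟨-, -, v', w', x', y', -, hmono', hl', hr'⟩ := h'
  constructor
  · refine eq_of_strictMono_comp_s11 rfl hp hp' (f := fun c => Dcheck v w x y (.inl c)) hl ?_
    exact fun i j hij => (Dcheck_lt_iff_of_strictMono hinj hmem hmono hmono'
      (by simpa using hp' i) (by simpa using hp' j)).2 (hl' hij)
  · refine eq_of_strictMono_comp_s11 rfl hq hq' (f := fun c => Dcheck v w x y (.inr c)) hr ?_
    exact fun i j hij => (Dcheck_lt_iff_of_strictMono hinj hmem hmono hmono'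
      (by simpa using hq' i) (by simpa using hq' j)).2 (hr' hij)

theorem exists_injOn_crossingSet {p q : Fin C.card → EuclideanSpace ℝ (Fin e)}
    (hp : ∀ i, p i ∈ C) (hq : ∀ i, q i ∈ C) {v w : EuclideanSpace ℝ (Fin e)}
    (ht : StrictMono (sqDist p v)) (hs : StrictMono (sqDist q w)) (hs0 : ∀ j, 0 < sqDist q w j)
    (hgen : NoTriplePoint (sqDist p v) (sqDist q w)) :
    ∃ g : LtPair C.card × LtPair C.card → Fin (C.card + C.card) →
        (EuclideanSpace ℝ (Fin e) ⊕ EuclideanSpace ℝ (Fin e)),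
      Set.InjOn g (crossingSet (sqDist p v) (sqDist q w)) ∧
      ∀ z ∈ crossingSet (sqDist p v) (sqDist q w), g z ∈ orderFiber C p q := by
  have hpr := range_eq_of_injective rfl
    (fun i j h => ht.injective (by simp only [sqDist, h])) hp
  have hqr := range_eq_of_injective rfl
    (fun i j h => hs.injective (by simp only [sqDist, h])) hq
  have hpC : ∀ c ∈ C, ∃ i, p i = c := fun c hc => by
    rw [← Finset.mem_coe, ← hpr] at hc; exact hc
  have hqC : ∀ c ∈ C, ∃ i, q i = c := fun c hc => by
    rw [← Finset.mem_coe, ← hqr] at hc; exact hc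
  have hex : ∀ z ∈ crossingSet (sqDist p v) (sqDist q w), ∃ (a b a₀ b₀ : ℝ) (σ : _),
      IsRightOfCrossing (sqDist p v) (sqDist q w) z a b a₀ b₀ ∧ Function.Injective σ ∧
      (∀ i : Fin (C.card + C.card), σ i ∈ C.disjSum C) ∧
      StrictMono fun i => Dcheck v w (b / (2 * √a)) √a (σ i) := by
    intro z hz
    obtain ⟨a, b, a₀, b₀, h⟩ := exists_isRightOfCrossing ht.injective hs hs0 hgen hz
    have hy : 0 < √a := Real.sqrt_pos.2 h.pos
    have hne : ∀ i j, Dcheck v w (b / (2 * √a)) √a (.inl (p i)) ≠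
        Dcheck v w (b / (2 * √a)) √a (.inr (q j)) := fun i j => by
      rcases lt_or_gt_of_ne (h.ne i j) with hlt | hlt
      · exact ((Dcheck_inl_lt_inr h.pos (hs0 j)).2 hlt).ne
      · exact ((Dcheck_inr_lt_inl h.pos (hs0 j)).2 hlt).ne'
    have hl : StrictMono fun i => Dcheck v w (b / (2 * √a)) √a (.inl (p i)) :=
      fun i j hij => Dcheck_inl_lt_inl.2 (ht hij)
    have hr : StrictMono fun i => Dcheck v w (b / (2 * √a)) √a (.inr (q i)) :=
      fun i j hij => (Dcheck_inr_lt_inr hy).2 (hs hij)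
    have hinj : Set.InjOn (Dcheck v w (b / (2 * √a)) √a) (C.disjSum C) := by
      rintro (c | c) hc (c' | c') hc' hcc
      · obtain ⟨i, rfl⟩ := hpC c (by simpa using hc)
        obtain ⟨j, rfl⟩ := hpC c' (by simpa using hc')
        rw [hl.injective hcc]
      · obtain ⟨i, rfl⟩ := hpC c (by simpa using hc)
        obtain ⟨j, rfl⟩ := hqC c' (by simpa using hc')
        exact absurd hcc (hne i j)
      · obtain ⟨i, rfl⟩ := hqC c (by simpa using hc)
        obtain ⟨j, rfl⟩ := hpC c' (by simpa using hc')
        exact absurd hcc.symm (hne j i)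
      · obtain ⟨i, rfl⟩ := hqC c (by simpa using hc)
        obtain ⟨j, rfl⟩ := hqC c' (by simpa using hc')
        rw [hr.injective hcc]
    obtain ⟨σ, hσ⟩ := exists_strictMono_enum (C.disjSum C) (Finset.card_disjSum C C) hinj
    exact ⟨a, b, a₀, b₀, σ, h, hσ⟩
  choose! a b a₀ b₀ g hcross hinj hmem hmono using hex
  refine ⟨g, fun z hz z' hz' hzz => ?_, fun z hz => ?_⟩
  · refine (hcross z hz).eq_of_iff ht.injective hs hs0 hgen (hcross z' hz') fun k l => ?_
    have hm' := hmono z' hz'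
    rw [← hzz] at hm'
    exact (Dcheck_inl_lt_inr (hcross z hz).pos (hs0 l)).symm.trans
      ((Dcheck_lt_iff_of_strictMono (hinj z hz) (hmem z hz) (hmono z hz) hm'
        (by simpa using hp k) (by simpa using hq l)).trans
      (Dcheck_inl_lt_inr (hcross z' hz').pos (hs0 l)))
  · have hy : 0 < √(a z) := Real.sqrt_pos.2 (hcross z hz).pos
    exact ⟨hinj z hz, hmem z hz, v, w, _, _, hy, hmono z hz,
      fun i j hij => Dcheck_inl_lt_inl.2 (ht hij),
      fun i j hij => (Dcheck_inr_lt_inr hy).2 (hs hij)⟩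

theorem exists_strictMono_sqDist {n : ℕ} {p : Fin n → EuclideanSpace ℝ (Fin e)}
    (hp : p ∈ PsiSet 1 n C) : ∃ v, StrictMono (sqDist p v) := by
  obtain ⟨-, -, V, hV, -, hmono⟩ := hp
  obtain ⟨v, rfl⟩ := Multiset.card_eq_one.1 hV
  refine ⟨v, fun i j hij => ?_⟩
  have := hmono hij
  simp only [sumDist, Multiset.map_singleton, Multiset.sum_singleton] at this
  exact pow_lt_pow_left₀ this dist_nonneg two_ne_zero

theorem exists_injective_orderFiber_union (he : 1 ≤ e)
    {p q : Fin C.card → EuclideanSpace ℝ (Fin e)}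
    (hp : p ∈ PsiSet 1 C.card C) (hq : q ∈ PsiSet 1 C.card C) (hpq : p ≠ q) :
    ∃ h : LtPair C.card × LtPair C.card → Fin (C.card + C.card) →
        (EuclideanSpace ℝ (Fin e) ⊕ EuclideanSpace ℝ (Fin e)),
      Function.Injective h ∧ ∀ z, h z ∈ orderFiber C p q ∪ orderFiber C q p := by
  classical
  obtain ⟨v₀, hv₀⟩ := exists_strictMono_sqDist hp
  obtain ⟨w₀, hw₀⟩ := exists_strictMono_sqDist hq
  obtain ⟨v, w, H⟩ := exists_isGenericPair he hv₀ hw₀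
  obtain ⟨g, hg, hgm⟩ := exists_injOn_crossingSet hp.2.1 hq.2.1 H.left_strictMono
    H.right_strictMono H.right_pos H.noTriple
  obtain ⟨g', hg', hgm'⟩ := exists_injOn_crossingSet hq.2.1 hp.2.1 H.right_strictMono
    H.left_strictMono H.left_pos H.noTriple_symm
  have hswap : ∀ z ∉ crossingSet (sqDist p v) (sqDist q w),
      z.swap ∈ crossingSet (sqDist q w) (sqDist p v) := fun z hz => by
    simp only [crossingSet, Set.mem_ofPred_eq, Prod.fst_swap, Prod.snd_swap] at hz ⊢
    have := lt_of_le_of_ne (not_lt.1 hz) fun h0 =>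
      H.ratio_ne z.1.1.1 z.1.1.2 z.2.1.1 z.2.1.2 z.2.2 (by rw [h0, sub_self])
    linarith
  have hdisj : ∀ σ, σ ∈ orderFiber C p q → σ ∉ orderFiber C q p := fun σ h h' =>
    hpq (eq_of_mem_orderFiber hp.2.1 hq.2.1 hq.2.1 hp.2.1 h h').1
  refine ⟨fun z => if z ∈ crossingSet (sqDist p v) (sqDist q w) then g z else g' z.swap,
    fun z z' hzz => ?_, fun z => ?_⟩
  · simp only at hzz
    split_ifs at hzz with h h' h'
    · exact hg h h' hzz
    · exact absurd (hzz ▸ hgm' _ (hswap _ h')) (hdisj _ (hgm _ h))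
    · exact absurd (hzz ▸ hgm' _ (hswap _ h)) (hdisj _ (hgm _ h'))
    · exact Prod.swap_injective (hg' (hswap _ h) (hswap _ h') hzz)
  · simp only
    split_ifs with h
    · exact Or.inl (hgm z h)
    · exact Or.inr (hgm' _ (hswap z h))

theorem finite_PsiSet (k n : ℕ) : (PsiSet k n C).Finite :=
  (Set.Finite.pi' fun _ => C.finite_toSet).subset fun _ h => h.2.1

theorem finite_PsiCheckSet (n : ℕ) : (PsiCheckSet n C C).Finite :=
  (Set.Finite.pi' fun _ => (C.disjSum C).finite_toSet).subset fun σ h i => by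
    have := h.2.1 i
    cases hi : σ i <;> simpa [hi] using this

end Fibers

/-- For every `d ≥ 2` (with `e = d − 1 ≥ 1`) and every finite set `C ⊆ ℝ^{d−1}`,
`ψ̌(C, C) ≥ (|C| choose 2)² · (ψ_1(C) choose 2)`. -/
theorem psiCheck_self_ge (e : ℕ) (he : 1 ≤ e) (C : Finset (EuclideanSpace ℝ (Fin e))) :
    (C.card.choose 2) ^ 2 * (psiCount 1 C).choose 2 ≤ psiCheck C C := by
  have : Finite (PsiSet 1 C.card C) := finite_PsiSet 1 _
  have : Finite (PsiCheckSet (C.card + C.card) C C) := finite_PsiCheckSet _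
  let E : PsiSet 1 C.card C ≃ Fin (psiCount 1 C) := Finite.equivFin _
  have hE : ∀ m, (E.symm m).1 ∈ PsiSet 1 C.card C := fun m => (E.symm m).2
  have hmem := fun m => (hE m).2.1
  have hinj : ∀ {m m'}, (E.symm m).1 = (E.symm m').1 → m = m' := fun h =>
    E.symm.injective (Subtype.ext h)
  choose h hh hhm using fun z : LtPair (psiCount 1 C) =>
    exists_injective_orderFiber_union he (hE z.1.1) (hE z.1.2) fun h => z.2.ne (hinj h)
  let F : LtPair (psiCount 1 C) × (LtPair C.card × LtPair C.card) →
      PsiCheckSet (C.card + C.card) C C := fun x =>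
    ⟨h x.1 x.2, Set.union_subset (orderFiber_subset _ _) (orderFiber_subset _ _) (hhm x.1 x.2)⟩
  have hF : Function.Injective F := by
    rintro ⟨⟨⟨m, n⟩, hz⟩, x⟩ ⟨⟨⟨m', n'⟩, hz'⟩, x'⟩ hxx
    have hxx := congrArg Subtype.val hxx
    simp only [F] at hxx
    have h₁ := hhm ⟨(m, n), hz⟩ x
    have h₂ := hhm ⟨(m', n'), hz'⟩ x'
    rw [← hxx] at h₂
    have hlt : m < n := hz
    have hlt' : m' < n' := hz'
    have heq : m = m' ∧ n = n' := by
      rcases h₁ with h₁ | h₁ <;> rcases h₂ with h₂ | h₂ <;>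
        obtain ⟨e₁, e₂⟩ := eq_of_mem_orderFiber (hmem _) (hmem _) (hmem _) (hmem _) h₁ h₂ <;>
        have e₁ := hinj e₁ <;> have e₂ := hinj e₂ <;> simp only at e₁ e₂ <;> omega
    obtain ⟨rfl, rfl⟩ := heq
    rw [hh _ hxx]
  have hcard := Nat.card_le_card_of_injective F hF
  rw [Nat.card_prod, Nat.card_prod, natCard_ltPair, natCard_ltPair] at hcard
  rw [psiCheck, sq, mul_comm]
  exact hcard
end
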